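/- arXiv:2603.06137 — 6 statements merged into one kernel-verified Lean document; each statement's English description precedes it below -/
import Mathlib

section
/- Let τ = (τ1, τ2) ∈ ℝ² with τ1 ≥ τ2 > 0 and τ1 + τ2 > 1, let B ⊆ [0,1]² be a ball of positive radius, let ε > 0, and let ρ = (ρ1, ρ2) ∈ ℚ² satisfy ρ1, ρ2 ≥ 1, ρ1 + ρ2 = 3, ρ1 ≥ ρ2, and 1 + τ_i − ρ_i > 0 for i = 1, 2. Set s_ρ := min{(3 + τ1 − τ2)/(1 + τ1), 3/(1 + τ2), 1 + ρ2/(1 + τ2)}. Then there exist a Borel probability measure μ on ℝ² whose support is contained in B ∩ B_2(Ψ_τ), and constants C > 0 and r₀ > 0, such that μ(F) ≤ C·r^{s_ρ − 2ε} for every ball F of radius r < r₀. -/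
open MeasureTheory Set

noncomputable section

/-- The set of Ψ-approximable vectors in `[0,1]^m`: points `x` such that for infinitely many
positive integers `q` there exists `p ∈ ℤ^m` with `|q * x i - p i| < Ψ q i` for all `i`. -/
def approxSet (m : ℕ) (Ψ : ℕ → Fin m → ℝ) : Set (Fin m → ℝ) :=
  {x | (∀ i, x i ∈ Set.Icc (0:ℝ) 1) ∧
    {q : ℕ | 0 < q ∧ ∃ p : Fin m → ℤ,
      ∀ i, |(q : ℝ) * x i - (p i : ℝ)| < Ψ q i}.Infinite}

/-- The set of weighted Ψ-badly approximable vectors: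
`B_m(Ψ) = A_m(Ψ) \ ⋂_{0<c<1} A_m(cΨ)`. -/
def badSet (m : ℕ) (Ψ : ℕ → Fin m → ℝ) : Set (Fin m → ℝ) :=
  approxSet m Ψ \ ⋂ c ∈ Set.Ioo (0:ℝ) 1, approxSet m (fun q i => c * Ψ q i)

/-- The power-law approximation function `Ψ_τ`, with `ψ_i(q) = q^{-τ_i}`. -/
def psiTau (m : ℕ) (τ : Fin m → ℝ) : ℕ → Fin m → ℝ :=
  fun q i => (q : ℝ) ^ (-(τ i))

/-- The topological support of a measure: points all of whose open neighbourhoods have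
positive measure. -/
def measSupport {X : Type*} [TopologicalSpace X] [MeasurableSpace X]
    (μ : Measure X) : Set X :=
  {x | ∀ U : Set X, IsOpen U → x ∈ U → 0 < μ U}

/-- Law of the point reached after `j` steps of the random descent with transition kernels
`κ n, κ (n + 1), …` started at the node `a` of level `n`. -/
def descentLaw {S X : Type*} [MeasurableSpace S] [MeasurableSpace X]
    (κ : ℕ → S → Measure S) (pt : S → X) : ℕ → ℕ → S → Measure X
  | _, 0, a => Measure.dirac (pt a)
  | n, j + 1, a => (κ n a).bind (descentLaw κ pt (n + 1) j)

section Descent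

variable {S X : Type*} [MeasurableSpace S] [DiscreteMeasurableSpace S] [MeasurableSpace X]
  {κ : ℕ → S → Measure S} {pt : S → X} {L : ℕ → Set S} {R : S → Set X}

theorem descentLaw_succ_apply (n j : ℕ) (a : S) {U : Set X} (hU : MeasurableSet U) :
    descentLaw κ pt n (j + 1) a U = ∫⁻ z, descentLaw κ pt (n + 1) j z U ∂(κ n a) := by
  rw [descentLaw, Measure.bind_apply hU (Measurable.of_discrete).aemeasurable]

theorem isProbabilityMeasure_descentLaw (hκ : ∀ n a, IsProbabilityMeasure (κ n a)) (j : ℕ) :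
    ∀ n a, IsProbabilityMeasure (descentLaw κ pt n j a) := by
  induction j with
  | zero => intro n a; rw [descentLaw]; infer_instance
  | succ j ih =>
    intro n a
    refine ⟨?_⟩
    have := hκ n a
    rw [descentLaw_succ_apply _ _ _ MeasurableSet.univ]
    simp [fun z => (ih (n + 1) z).measure_univ]

theorem descentLaw_eq_zero_of_disjoint
    (hL : ∀ n, ∀ a ∈ L n, ∀ᵐ z ∂(κ n a), z ∈ L (n + 1) ∧ R z ⊆ R a) (hpt : ∀ z, pt z ∈ R z)
    {U : Set X} (hU : MeasurableSet U) (j : ℕ) :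
    ∀ n, ∀ a ∈ L n, Disjoint (R a) U → descentLaw κ pt n j a U = 0 := by
  induction j with
  | zero =>
    intro n a _ hd
    rw [descentLaw, Measure.dirac_apply' _ hU]
    simpa using Set.disjoint_left.1 hd (hpt a)
  | succ j ih =>
    intro n a ha hd
    rw [descentLaw_succ_apply _ _ _ hU]
    rw [lintegral_congr_ae (g := fun _ => 0)]
    · simp
    · filter_upwards [hL n a ha] with z hz
      exact ih _ _ hz.1 (hd.mono_left hz.2)

theorem descentLaw_succ_le
    (hL : ∀ n, ∀ a ∈ L n, ∀ᵐ z ∂(κ n a), z ∈ L (n + 1) ∧ R z ⊆ R a) (hpt : ∀ z, pt z ∈ R z)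
    {U : Set X} (hU : MeasurableSet U) {n j : ℕ} {c : ENNReal}
    (hc : ∀ a ∈ L (n + 1), descentLaw κ pt (n + 1) j a U ≤ c) {a : S} (ha : a ∈ L n) :
    descentLaw κ pt n (j + 1) a U ≤ c * κ n a {z | (R z ∩ U).Nonempty} := by
  rw [descentLaw_succ_apply _ _ _ hU]
  calc ∫⁻ z, descentLaw κ pt (n + 1) j z U ∂(κ n a)
      ≤ ∫⁻ z, {z | (R z ∩ U).Nonempty}.indicator (fun _ => c) z ∂(κ n a) := by
        refine lintegral_mono_ae ?_
        filter_upwards [hL n a ha] with z hz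
        by_cases h : (R z ∩ U).Nonempty
        · rw [Set.indicator_of_mem (by exact h)]
          exact hc z hz.1
        · rw [descentLaw_eq_zero_of_disjoint hL hpt hU _ _ _ hz.1
            (Set.disjoint_iff_inter_eq_empty.2 (Set.not_nonempty_iff_eq_empty.1 h))]
          exact zero_le
    _ = c * κ n a {z | (R z ∩ U).Nonempty} := by
        rw [lintegral_indicator_const (MeasurableSet.of_discrete)]

theorem descentLaw_add_le (hκ : ∀ n a, IsProbabilityMeasure (κ n a))
    (hL : ∀ n, ∀ a ∈ L n, ∀ᵐ z ∂(κ n a), z ∈ L (n + 1) ∧ R z ⊆ R a) (hpt : ∀ z, pt z ∈ R z)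
    {U : Set X} (hU : MeasurableSet U) {j n : ℕ} {c : ENNReal}
    (hc : ∀ a ∈ L n, descentLaw κ pt n j a U ≤ c) (i : ℕ) :
    ∀ m, m + i = n → ∀ a ∈ L m, descentLaw κ pt m (j + i) a U ≤ c := by
  induction i with
  | zero => rintro m rfl; exact hc
  | succ i ih =>
    intro m hm a ha
    have := hκ m a
    calc descentLaw κ pt m (j + i + 1) a U ≤ c * κ m a {z | (R z ∩ U).Nonempty} :=
          descentLaw_succ_le hL hpt hU (ih (m + 1) (by omega)) ha
      _ ≤ c * 1 := by gcongr; exact prob_le_one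
      _ = c := mul_one c

/-- A nested family of compact sets indexed by a tree, with transition probabilities, carries a
probability measure on the limit set whose mass on open sets is controlled by the probabilities
of two consecutive steps. -/
theorem exists_measure_of_descent [TopologicalSpace X] [T2Space X] [NormalSpace X]
    [HasOuterApproxClosed X] [BorelSpace X]
    (hκ : ∀ n a, IsProbabilityMeasure (κ n a))
    (hL : ∀ n, ∀ a ∈ L n, ∀ᵐ z ∂(κ n a), z ∈ L (n + 1) ∧ R z ⊆ R a)
    (hR : ∀ z, (R z).Nonempty) {a₀ : S} (ha₀ : a₀ ∈ L 0) (hc : IsCompact (R a₀)) :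
    ∃ μ : Measure X, IsProbabilityMeasure μ ∧
      (∀ n U, IsOpen U → (∀ z ∈ L n, Disjoint (R z) U) → μ U = 0) ∧
      ∀ n U b b', IsOpen U → (∀ a ∈ L n, κ n a {z | (R z ∩ U).Nonempty} ≤ b) →
        (∀ a ∈ L (n + 1), κ (n + 1) a {z | (R z ∩ U).Nonempty} ≤ b') → μ U ≤ b' * b := by
  choose pt hpt using hR
  have hprob := fun j => isProbabilityMeasure_descentLaw (pt := pt) hκ j 0 a₀
  let ν : ℕ → ProbabilityMeasure X := fun j => ⟨descentLaw κ pt 0 j a₀, hprob j⟩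
  have hK := isCompact_setOfPred_probabilityMeasure_mass_eq_compl_isCompact_le (E := X)
    (u := fun _ => 0) (K := fun _ => R a₀) tendsto_const_nhds (fun _ => hc) (Or.inr monotone_const)
  obtain ⟨μ, -, hμ⟩ := hK.ultrafilter_le_nhds ((Filter.hyperfilter ℕ).map ν) (by
    simp only [Filter.le_principal_iff]
    refine Filter.mem_map.2 (Filter.univ_mem' fun j => ?_)
    intro _
    have : descentLaw κ pt 0 j a₀ (R a₀)ᶜ = 0 :=
      descentLaw_eq_zero_of_disjoint hL hpt hc.isClosed.isOpen_compl.measurableSet j 0 a₀ ha₀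
        disjoint_compl_right
    rw [ProbabilityMeasure.coeFn_def]
    simp [ν, this])
  have hle : ∀ U, IsOpen U → ∀ (c : ENNReal) (N : ℕ),
      (∀ j, N ≤ j → descentLaw κ pt 0 j a₀ U ≤ c) → (μ : Measure X) U ≤ c := by
    intro U hU c N h
    have hlim : Filter.Tendsto ν (Filter.hyperfilter ℕ : Filter ℕ) (nhds μ) := hμ
    refine (ProbabilityMeasure.le_liminf_measure_open_of_tendsto hlim hU).trans ?_
    refine Filter.liminf_le_of_frequently_le' (Filter.Eventually.frequently ?_)
    exact Nat.hyperfilter_le_atTop (Filter.eventually_atTop.2 ⟨N, h⟩)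
  refine ⟨μ, inferInstance, ?_, ?_⟩
  · intro n U hU hd
    refine le_antisymm (hle U hU 0 n fun j hj => ?_) zero_le
    obtain ⟨i, rfl⟩ := Nat.exists_eq_add_of_le' hj
    exact descentLaw_add_le hκ hL hpt hU.measurableSet
      (fun a ha => (descentLaw_eq_zero_of_disjoint hL hpt hU.measurableSet i n a ha
        (hd a ha)).le) n 0 (by omega) a₀ ha₀
  · intro n U b b' hU hb hb'
    refine hle U hU _ (n + 2) fun j hj => ?_
    obtain ⟨i, rfl⟩ := Nat.exists_eq_add_of_le' hj
    rw [show i + (n + 2) = (i + 2) + n by omega]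
    have h1 : ∀ a ∈ L (n + 1), descentLaw κ pt (n + 1) (i + 1) a U ≤ b' := by
      intro a ha
      refine (descentLaw_succ_le (c := 1) hL hpt hU.measurableSet (fun z _ => ?_) ha).trans ?_
      · have := isProbabilityMeasure_descentLaw (pt := pt) hκ i (n + 1 + 1) z
        exact prob_le_one
      · rw [one_mul]; exact hb' a ha
    have h2 : ∀ a ∈ L n, descentLaw κ pt n (i + 2) a U ≤ b' * b := by
      intro a ha
      refine (descentLaw_succ_le hL hpt hU.measurableSet h1 ha).trans ?_
      gcongr
      exact hb a ha
    exact descentLaw_add_le hκ hL hpt hU.measurableSet h2 n 0 (Nat.zero_add n) a₀ ha₀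

end Descent

/-- The rational point `(p₁ / q, p₂ / q)` encoded by the pair `(q, p)`. -/
def ratPoint (z : ℕ × (Fin 2 → ℤ)) : Fin 2 → ℝ := fun i => (z.2 i : ℝ) / z.1

/-- A rational point with denominator `q` is regular for the weights `w` if the lattice generated
by it and `ℤ²` has no nonzero point in the open box with half-sides `q ^ (-w i)`. -/
def IsRegularPoint (w : Fin 2 → ℝ) (z : ℕ × (Fin 2 → ℤ)) : Prop :=
  0 < z.1 ∧ ∀ (a : ℤ) (b : Fin 2 → ℤ),
    (∀ i, |(a : ℝ) * ratPoint z i - b i| < (z.1 : ℝ) ^ (-w i)) →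
      ∃ k : ℤ, a = k * z.1 ∧ ∀ i, b i = k * z.2 i

/-- The closed box of points `x` with
`α q ^ (-(1 + τ i)) ≤ x i - p i / q ≤ β q ^ (-(1 + τ i))`. -/
def shell (τ : Fin 2 → ℝ) (α β : ℝ) (z : ℕ × (Fin 2 → ℤ)) : Set (Fin 2 → ℝ) :=
  Set.Icc (fun i => ratPoint z i + α * (z.1 : ℝ) ^ (-(1 + τ i)))
    (fun i => ratPoint z i + β * (z.1 : ℝ) ^ (-(1 + τ i)))

theorem isRegularPoint_of_minimal {w y H : Fin 2 → ℝ} {z : ℕ × (Fin 2 → ℤ)} (hz : 0 < z.1)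
    (hy : ∀ i, |(z.1 : ℝ) * y i - z.2 i| ≤ H i)
    (hmin : ∀ a : ℕ, 0 < a → a < z.1 → ∀ b : Fin 2 → ℤ, ¬ ∀ i, |(a : ℝ) * y i - b i| ≤ H i)
    (hw : ∀ i, (z.1 : ℝ) ^ (-w i) ≤ H i / 2) (hw1 : ∀ i, (z.1 : ℝ) ^ (-w i) ≤ 1) :
    IsRegularPoint w z := by
  refine ⟨hz, fun a b hab => ?_⟩
  have hq : (0 : ℝ) < z.1 := by exact_mod_cast hz
  set k : ℤ := round ((a : ℝ) / z.1) with hk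
  have hround : |(a : ℝ) - k * z.1| ≤ z.1 / 2 := by
    have h := abs_sub_round ((a : ℝ) / z.1)
    have h2 : (a : ℝ) - k * z.1 = ((a : ℝ) / z.1 - k) * z.1 := by field_simp
    rw [h2, abs_mul, abs_of_pos hq]
    nlinarith
  have hsub : ∀ i, (a : ℝ) * ratPoint z i - b i =
      ((a : ℝ) - k * z.1) * ratPoint z i - ((b i : ℝ) - k * z.2 i) := by
    intro i
    simp only [ratPoint]
    field_simp
    ring
  have hbound : ∀ i, |((a : ℝ) - k * z.1) * y i - ((b i : ℝ) - k * z.2 i)| ≤ H i := by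
    intro i
    have h1 : ((a : ℝ) - k * z.1) * y i - ((b i : ℝ) - k * z.2 i) =
        ((a : ℝ) * ratPoint z i - b i) +
          (((a : ℝ) - k * z.1) / z.1) * ((z.1 : ℝ) * y i - z.2 i) := by
      rw [hsub i]
      simp only [ratPoint]
      field_simp
      ring
    have h2 : |(((a : ℝ) - k * z.1) / z.1)| ≤ 1 / 2 := by
      rw [abs_div, abs_of_pos hq, div_le_iff₀ hq]
      linarith
    rw [h1]
    refine (abs_add_le _ _).trans ?_
    rw [abs_mul]
    have h3 := mul_le_mul h2 (hy i) (abs_nonneg _) (by norm_num)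
    linarith [(hab i).le, hw i]
  have hcast : (((a - k * z.1 : ℤ)) : ℝ) = (a : ℝ) - k * z.1 := by push_cast; ring
  have hzero : a - k * z.1 = 0 := by
    by_contra hne
    have hlt : (a - k * z.1).natAbs < z.1 := by
      have : ((a - k * z.1).natAbs : ℝ) < z.1 := by
        rw [Nat.cast_natAbs, Int.cast_abs, hcast]
        linarith
      exact_mod_cast this
    rcases Int.natAbs_eq (a - k * z.1) with h | h
    · refine hmin _ (Int.natAbs_pos.2 hne) hlt (fun i => b i - k * z.2 i) fun i => ?_
      have h4 : (((a - k * z.1).natAbs : ℕ) : ℝ) = (a : ℝ) - k * z.1 := by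
        rw [← hcast, ← Int.cast_natCast, ← h]
      rw [h4]
      push_cast
      exact hbound i
    · refine hmin _ (Int.natAbs_pos.2 hne) hlt (fun i => -(b i - k * z.2 i)) fun i => ?_
      have h4 : (((a - k * z.1).natAbs : ℕ) : ℝ) = -((a : ℝ) - k * z.1) := by
        have : (((a - k * z.1).natAbs : ℕ) : ℤ) = -(a - k * z.1) := by omega
        rw [← hcast, ← Int.cast_natCast, this, Int.cast_neg]
      rw [h4, ← abs_neg]
      push_cast
      convert hbound i using 2
      ring
  refine ⟨k, by linarith, fun i => ?_⟩
  have h5 := (hab i).trans_le (hw1 i)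
  rw [hsub i, ← hcast, hzero, Int.cast_zero, zero_mul, zero_sub, abs_neg] at h5
  have h6 : |b i - k * z.2 i| < 1 := by exact_mod_cast h5
  have := Int.abs_lt_one_iff.1 h6
  linarith

/-- Dirichlet's theorem on simultaneous approximation, with one cell count per coordinate. -/
theorem exists_simultaneous_approx (y : Fin 2 → ℝ) (M : Fin 2 → ℕ) (hM : ∀ i, 0 < M i) {Q : ℕ}
    (hMQ : ∏ i, M i ≤ Q) :
    ∃ q : ℕ, 0 < q ∧ q ≤ Q ∧ ∃ p : Fin 2 → ℤ, ∀ i, |(q : ℝ) * y i - p i| ≤ 1 / M i := by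
  let f : ℕ → Fin 2 → ℕ := fun n i => ⌊Int.fract ((n : ℝ) * y i) * M i⌋₊
  have hmaps : ∀ n ∈ Finset.range (Q + 1), f n ∈ Fintype.piFinset fun i => Finset.range (M i) := by
    intro n _
    rw [Fintype.mem_piFinset]
    intro i
    have hMi : (0 : ℝ) < M i := by exact_mod_cast hM i
    rw [Finset.mem_range, Nat.floor_lt (mul_nonneg (Int.fract_nonneg _) hMi.le)]
    nlinarith [Int.fract_lt_one ((n : ℝ) * y i)]
  obtain ⟨m, hm, n, hn, hne, hmn⟩ := Finset.exists_ne_map_eq_of_card_lt_of_maps_to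
    (s := Finset.range (Q + 1)) (by simp only [Fintype.card_piFinset, Finset.card_range]; omega)
    hmaps
  wlog hlt : m < n generalizing m n
  · exact this n hn m hm hne.symm hmn.symm (by omega)
  simp only [Finset.mem_range] at hm hn
  refine ⟨n - m, by omega, by omega,
    fun i => ⌊(n : ℝ) * y i⌋ - ⌊(m : ℝ) * y i⌋, fun i => ?_⟩
  have hMi : (0 : ℝ) < M i := by exact_mod_cast hM i
  have hi : f m i = f n i := congrFun hmn i
  have h : |Int.fract ((n : ℝ) * y i) * M i - Int.fract ((m : ℝ) * y i) * M i| < 1 := by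
    simp only [f] at hi
    have hn0 := mul_nonneg (Int.fract_nonneg ((n : ℝ) * y i)) hMi.le
    have hm0 := mul_nonneg (Int.fract_nonneg ((m : ℝ) * y i)) hMi.le
    have h1 := Nat.floor_le hn0
    have h2 := Nat.floor_le hm0
    have h3 := Nat.lt_floor_add_one (Int.fract ((n : ℝ) * y i) * M i)
    have h4 := Nat.lt_floor_add_one (Int.fract ((m : ℝ) * y i) * M i)
    rw [hi] at h2 h4
    rw [abs_lt]
    constructor <;> linarith
  rw [← sub_mul, abs_mul, abs_of_pos hMi] at h
  rw [le_div_iff₀ hMi]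
  have e : ((n - m : ℕ) : ℝ) * y i - ((⌊(n : ℝ) * y i⌋ - ⌊(m : ℝ) * y i⌋ : ℤ) : ℝ) =
      Int.fract ((n : ℝ) * y i) - Int.fract ((m : ℝ) * y i) := by
    rw [Nat.cast_sub hlt.le, ← Int.self_sub_floor, ← Int.self_sub_floor]
    push_cast
    ring
  rw [e]
  exact h.le

theorem exists_regular_of_forall_not_approx {v w y : Fin 2 → ℝ} (hv : ∀ i, 0 < v i)
    (hv1 : ∑ i, v i = 1) (hw : ∀ i, 0 < w i) {Q : ℕ} (hQ : 0 < Q) {N : ℝ} (hN : 1 ≤ N)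
    (hNw : ∀ i, N ^ (-w i) ≤ (Q : ℝ) ^ (-v i))
    (hy : ∀ a : ℕ, 0 < a → (a : ℝ) ≤ N → ∀ b : Fin 2 → ℤ,
      ¬ ∀ i, |(a : ℝ) * y i - b i| ≤ 2 * (Q : ℝ) ^ (-v i)) :
    ∃ z : ℕ × (Fin 2 → ℤ), IsRegularPoint w z ∧ N < z.1 ∧ z.1 ≤ Q ∧
      ∀ i, |(z.1 : ℝ) * y i - z.2 i| ≤ 2 * (Q : ℝ) ^ (-v i) := by
  classical
  have hQ1 : (1 : ℝ) ≤ Q := by exact_mod_cast hQ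
  have hQ0 : (0 : ℝ) < Q := by linarith
  have hM : ∀ i, 0 < ⌊(Q : ℝ) ^ v i⌋₊ := fun i =>
    Nat.floor_pos.2 (Real.one_le_rpow hQ1 (hv i).le)
  have hex : ∃ a : ℕ, 0 < a ∧ a ≤ Q ∧ ∃ b : Fin 2 → ℤ,
      ∀ i, |(a : ℝ) * y i - b i| ≤ 2 * (Q : ℝ) ^ (-v i) := by
    obtain ⟨q, hq, hqQ, p, hp⟩ := exists_simultaneous_approx y (fun i => ⌊(Q : ℝ) ^ v i⌋₊) hM
      (Q := Q) (by
        have : ((∏ i, ⌊(Q : ℝ) ^ v i⌋₊ : ℕ) : ℝ) ≤ Q := by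
          push_cast
          calc ∏ i, (⌊(Q : ℝ) ^ v i⌋₊ : ℝ) ≤ ∏ i, (Q : ℝ) ^ v i :=
                Finset.prod_le_prod (fun i _ => by positivity)
                  fun i _ => Nat.floor_le (by positivity)
            _ = (Q : ℝ) ^ ∑ i, v i := (Real.rpow_sum_of_pos hQ0 _ _).symm
            _ = Q := by rw [hv1, Real.rpow_one]
        exact_mod_cast this)
    refine ⟨q, hq, hqQ, p, fun i => (hp i).trans ?_⟩
    have hpos : (0 : ℝ) < (Q : ℝ) ^ v i := by positivity
    have hMi : (1 : ℝ) ≤ ⌊(Q : ℝ) ^ v i⌋₊ := by exact_mod_cast hM i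
    rw [Real.rpow_neg hQ0.le, div_le_iff₀ (by linarith)]
    have h2 := Nat.lt_floor_add_one ((Q : ℝ) ^ v i)
    have h3 : (Q : ℝ) ^ v i ≤ 2 * ⌊(Q : ℝ) ^ v i⌋₊ := by linarith
    calc (1 : ℝ) = ((Q : ℝ) ^ v i)⁻¹ * (Q : ℝ) ^ v i := by field_simp
      _ ≤ ((Q : ℝ) ^ v i)⁻¹ * (2 * ⌊(Q : ℝ) ^ v i⌋₊) := by gcongr
      _ = _ := by ring
  obtain ⟨hq, hqQ, p, hp⟩ := Nat.find_spec hex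
  set q := Nat.find hex with hqdef
  have hNq : N < q := by
    by_contra h
    exact hy q hq (not_lt.1 h) p hp
  have hqw : ∀ i, (q : ℝ) ^ (-w i) ≤ (Q : ℝ) ^ (-v i) := fun i =>
    (Real.rpow_le_rpow_of_nonpos (by linarith) hNq.le (by linarith [hw i])).trans (hNw i)
  refine ⟨(q, p), isRegularPoint_of_minimal (y := y) (H := fun i => 2 * (Q : ℝ) ^ (-v i)) hq hp
    ?_ ?_ ?_, hNq, hqQ, hp⟩
  · intro a ha haq b hb
    exact Nat.find_min hex haq ⟨ha, by
      change a < q at haq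
      omega, b, hb⟩
  · intro i
    have := hqw i
    simp only
    linarith
  · intro i
    exact Real.rpow_le_one_of_one_le_of_nonpos (by simp only; linarith) (by linarith [hw i])

/-- The pair `s = (q', p')` is an integer multiple of the pair `z = (q, p)`. -/
def IsMultipleOf (s z : ℕ × (Fin 2 → ℤ)) : Prop :=
  ∃ k : ℤ, (s.1 : ℤ) = k * z.1 ∧ ∀ i, s.2 i = k * z.2 i

theorem finite_and_ncard_le_of_regular {w A : Fin 2 → ℝ} {z : ℕ × (Fin 2 → ℤ)}
    (hz : IsRegularPoint w z) (k : ℕ) {X : ℝ} (hX : 0 ≤ X)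
    (hA : ∀ i, 2 * A i ≤ X * (z.1 : ℝ) ^ (-w i)) :
    {s : ℕ × (Fin 2 → ℤ) | k * z.1 ≤ s.1 ∧ s.1 < (k + 1) * z.1 ∧
        ∀ i, |(s.1 : ℝ) * ratPoint z i - s.2 i| ≤ A i}.Finite ∧
      ({s : ℕ × (Fin 2 → ℤ) | k * z.1 ≤ s.1 ∧ s.1 < (k + 1) * z.1 ∧
        ∀ i, |(s.1 : ℝ) * ratPoint z i - s.2 i| ≤ A i}.ncard : ℝ) ≤ (X + 1) ^ 2 := by
  set I := {s : ℕ × (Fin 2 → ℤ) | k * z.1 ≤ s.1 ∧ s.1 < (k + 1) * z.1 ∧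
        ∀ i, |(s.1 : ℝ) * ratPoint z i - s.2 i| ≤ A i} with hI
  have hq : (0 : ℝ) < z.1 := by exact_mod_cast hz.1
  let g : ℕ × (Fin 2 → ℤ) → Fin 2 → ℕ := fun s i =>
    ⌊((s.1 : ℝ) * ratPoint z i - s.2 i + A i) / (z.1 : ℝ) ^ (-w i)⌋₊
  let T : Finset (Fin 2 → ℕ) := Fintype.piFinset fun _ => Finset.range (⌊X⌋₊ + 1)
  have hmaps : MapsTo g I T := by
    intro s hs
    rw [Finset.mem_coe, Fintype.mem_piFinset]
    intro i
    have hw : (0 : ℝ) < (z.1 : ℝ) ^ (-w i) := by positivity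
    rw [Finset.mem_range, Nat.lt_succ_iff]
    refine Nat.floor_le_floor ?_
    rw [div_le_iff₀ hw]
    linarith [hA i, (abs_le.1 (hs.2.2 i)).2]
  have hinj : InjOn g I := by
    intro s hs t ht hst
    obtain ⟨m, hm, hmp⟩ := hz.2 ((s.1 : ℤ) - t.1) (fun i => s.2 i - t.2 i) fun i => by
      have hw : (0 : ℝ) < (z.1 : ℝ) ^ (-w i) := by positivity
      have hi : g s i = g t i := congrFun hst i
      simp only [g] at hi
      have hs0 : 0 ≤ ((s.1 : ℝ) * ratPoint z i - s.2 i + A i) / (z.1 : ℝ) ^ (-w i) :=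
        div_nonneg (by linarith [(abs_le.1 (hs.2.2 i)).1]) hw.le
      have ht0 : 0 ≤ ((t.1 : ℝ) * ratPoint z i - t.2 i + A i) / (z.1 : ℝ) ^ (-w i) :=
        div_nonneg (by linarith [(abs_le.1 (ht.2.2 i)).1]) hw.le
      have h1 := Nat.floor_le hs0
      have h2 := Nat.floor_le ht0
      have h3 := Nat.lt_floor_add_one
        (((s.1 : ℝ) * ratPoint z i - s.2 i + A i) / (z.1 : ℝ) ^ (-w i))
      have h4 := Nat.lt_floor_add_one
        (((t.1 : ℝ) * ratPoint z i - t.2 i + A i) / (z.1 : ℝ) ^ (-w i))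
      rw [hi] at h1 h3
      have h5 : |((s.1 : ℝ) * ratPoint z i - s.2 i + A i) / (z.1 : ℝ) ^ (-w i) -
          ((t.1 : ℝ) * ratPoint z i - t.2 i + A i) / (z.1 : ℝ) ^ (-w i)| < 1 := by
        rw [abs_lt]
        constructor <;> linarith
      rw [← sub_div, abs_div, abs_of_pos hw, div_lt_one hw] at h5
      refine lt_of_eq_of_lt (congrArg abs ?_) h5
      push_cast
      ring
    have hm0 : m = 0 := by
      have h1 : (s.1 : ℤ) < (k + 1) * z.1 := by exact_mod_cast hs.2.1
      have h2 : (t.1 : ℤ) < (k + 1) * z.1 := by exact_mod_cast ht.2.1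
      have h3 : (k : ℤ) * z.1 ≤ s.1 := by exact_mod_cast hs.1
      have h4 : (k : ℤ) * z.1 ≤ t.1 := by exact_mod_cast ht.1
      have h5 : (0 : ℤ) < z.1 := by exact_mod_cast hz.1
      have h6 : m < 1 := by nlinarith
      have h7 : -1 < m := by nlinarith
      omega
    subst hm0
    refine Prod.ext ?_ (funext fun i => ?_)
    · omega
    · have := hmp i
      simp only [zero_mul] at this
      linarith
  have hfin : I.Finite := Set.Finite.of_injOn hmaps hinj T.finite_toSet
  refine ⟨hfin, ?_⟩
  have hcard : I.ncard ≤ (⌊X⌋₊ + 1) ^ 2 := by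
    have h := Set.ncard_le_ncard_of_injOn g hmaps hinj T.finite_toSet
    rw [Set.ncard_coe_finset, Fintype.card_piFinset] at h
    simpa using h
  have h1 : (⌊X⌋₊ : ℝ) ≤ X := Nat.floor_le hX
  calc (I.ncard : ℝ) ≤ ((⌊X⌋₊ + 1) ^ 2 : ℕ) := by exact_mod_cast hcard
    _ = ((⌊X⌋₊ : ℝ) + 1) ^ 2 := by push_cast; ring
    _ ≤ (X + 1) ^ 2 := by gcongr

theorem volume_forall_abs_lt_le {s : ℕ × (Fin 2 → ℤ)} (hs : 0 < s.1) (θ : Fin 2 → ℝ) :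
    volume {y : Fin 2 → ℝ | ∀ i, |(s.1 : ℝ) * y i - s.2 i| < θ i} ≤
      ∏ i, ENNReal.ofReal (2 * θ i / s.1) := by
  have hq : (0 : ℝ) < s.1 := by exact_mod_cast hs
  calc volume {y : Fin 2 → ℝ | ∀ i, |(s.1 : ℝ) * y i - s.2 i| < θ i}
      ≤ volume (Icc (fun i => ((s.2 i : ℝ) - θ i) / s.1) fun i => ((s.2 i : ℝ) + θ i) / s.1) := by
        refine measure_mono fun y hy => ⟨fun i => ?_, fun i => ?_⟩
        · have := (abs_lt.1 (hy i)).1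
          rw [div_le_iff₀ hq]
          linarith
        · have := (abs_lt.1 (hy i)).2
          rw [le_div_iff₀ hq]
          linarith
    _ = ∏ i, ENNReal.ofReal (2 * θ i / s.1) := by
        rw [Real.volume_Icc_pi]
        refine Finset.prod_congr rfl fun i _ => ?_
        congr 1
        ring

theorem volume_shell_block_le {τ v w e : Fin 2 → ℝ} {l d : ℝ} {z : ℕ × (Fin 2 → ℤ)}
    (hz : IsRegularPoint w z) (hτ : ∀ i, 0 < τ i) (hv : ∀ i, 0 < v i) (hv1 : ∑ i, v i = 1)
    (hl : 0 ≤ l) (hwd : ∀ i, w i + d ≤ τ i) (hlv : ∀ i, l * v i ≤ τ i) {k : ℕ} (hk : 0 < k)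
    (he : ∀ i, e i ≤ (z.1 : ℝ) ^ (-τ i) * (k : ℝ) ^ (-(l * v i))) :
    volume {y | y ∈ shell τ 0 1 z ∧ ∃ s : ℕ × (Fin 2 → ℤ), k * z.1 ≤ s.1 ∧ s.1 < (k + 1) * z.1 ∧
        ¬ IsMultipleOf s z ∧ ∀ i, |(s.1 : ℝ) * y i - s.2 i| < (s.1 : ℝ) ^ (-τ i) + e i} ≤
      ENNReal.ofReal (4096 * (z.1 : ℝ) ^ (-(2 * d)) * (∏ i, (z.1 : ℝ) ^ (-(1 + τ i))) *
        (k : ℝ) ^ (-l)) := by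
  have hq : (0 : ℝ) < z.1 := by exact_mod_cast hz.1
  have hq1 : (1 : ℝ) ≤ z.1 := by exact_mod_cast hz.1
  have hk1 : (1 : ℝ) ≤ k := by exact_mod_cast hk
  have hk0 : (0 : ℝ) < k := by linarith
  set B : Fin 2 → ℝ := fun i => (z.1 : ℝ) ^ (-τ i) * (k : ℝ) ^ (-(l * v i)) with hB
  have hBle : ∀ i, B i ≤ (z.1 : ℝ) ^ (-τ i) := fun i => by
    have : (k : ℝ) ^ (-(l * v i)) ≤ 1 :=
      Real.rpow_le_one_of_one_le_of_nonpos hk1 (by have := mul_nonneg hl (hv i).le; linarith)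
    exact mul_le_of_le_one_right (by positivity) this
  have hθ : ∀ s : ℕ, k * z.1 ≤ s → ∀ i, (s : ℝ) ^ (-τ i) + e i ≤ 2 * B i := by
    intro s hs i
    have hs' : (k : ℝ) * z.1 ≤ s := by exact_mod_cast hs
    have h1 : (s : ℝ) ^ (-τ i) ≤ (k * z.1 : ℝ) ^ (-τ i) :=
      Real.rpow_le_rpow_of_nonpos (by positivity) hs' (by linarith [hτ i])
    rw [Real.mul_rpow hk0.le hq.le] at h1
    have h2 : (k : ℝ) ^ (-τ i) ≤ (k : ℝ) ^ (-(l * v i)) :=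
      Real.rpow_le_rpow_of_exponent_le hk1 (by linarith [hlv i])
    have h3 : (k : ℝ) ^ (-τ i) * (z.1 : ℝ) ^ (-τ i) ≤ B i := by
      rw [mul_comm]; simp only [hB]; gcongr
    linarith [he i]
  set A : Fin 2 → ℝ := fun i => 4 * k * (z.1 : ℝ) ^ (-τ i) with hA
  have hmem : ∀ y ∈ shell τ 0 1 z, ∀ s : ℕ × (Fin 2 → ℤ), k * z.1 ≤ s.1 → s.1 < (k + 1) * z.1 →
      (∀ i, |(s.1 : ℝ) * y i - s.2 i| < (s.1 : ℝ) ^ (-τ i) + e i) →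
      ∀ i, |(s.1 : ℝ) * ratPoint z i - s.2 i| ≤ A i := by
    intro y hy s hs1 hs2 hs i
    have h1 := hy.1 i
    have h2 := hy.2 i
    simp only [zero_mul, add_zero, one_mul] at h1 h2
    have hs2' : (s.1 : ℝ) ≤ (k + 1) * z.1 := by exact_mod_cast hs2.le
    have h3 : |(s.1 : ℝ) * (y i - ratPoint z i)| ≤ (k + 1) * (z.1 : ℝ) ^ (-τ i) := by
      rw [abs_of_nonneg (mul_nonneg (by positivity) (by linarith))]
      calc (s.1 : ℝ) * (y i - ratPoint z i) ≤ ((k + 1) * z.1) * (z.1 : ℝ) ^ (-(1 + τ i)) := by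
            gcongr
            linarith
        _ = (k + 1) * (z.1 : ℝ) ^ (-τ i) := by
            rw [neg_add, Real.rpow_add hq, Real.rpow_neg_one]
            field_simp
    have h4 : (s.1 : ℝ) * ratPoint z i - s.2 i =
        ((s.1 : ℝ) * y i - s.2 i) - (s.1 : ℝ) * (y i - ratPoint z i) := by ring
    rw [h4]
    refine (abs_sub _ _).trans ?_
    have h5 := hs i
    have h6 := hθ s.1 hs1 i
    have h7 := hBle i
    simp only [hA]
    have h8 : (0 : ℝ) < (z.1 : ℝ) ^ (-τ i) := by positivity
    nlinarith
  have hqd : ∀ i, (z.1 : ℝ) ^ (-τ i) ≤ (z.1 : ℝ) ^ (-d) * (z.1 : ℝ) ^ (-w i) := fun i => by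
    rw [← Real.rpow_add hq]
    exact Real.rpow_le_rpow_of_exponent_le hq1 (by linarith [hwd i])
  set X : ℝ := 8 * k * (z.1 : ℝ) ^ (-d) with hXdef
  have hX : 0 ≤ X := by positivity
  have hAX : ∀ i, 2 * A i ≤ X * (z.1 : ℝ) ^ (-w i) := fun i => by
    have := mul_le_mul_of_nonneg_left (hqd i) (by positivity : (0 : ℝ) ≤ 8 * k)
    simp only [hA, hXdef]
    linarith
  rcases lt_or_ge X 1 with hX1 | hX1
  · refine le_of_eq_of_le (b := (0 : ENNReal)) ?_ zero_le
    refine (congrArg volume (Set.eq_empty_of_forall_notMem ?_)).trans measure_empty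
    rintro y ⟨hy, s, hs1, hs2, hs3, hs4⟩
    refine hs3 (hz.2 s.1 s.2 fun i => ?_)
    have hw : (0 : ℝ) < (z.1 : ℝ) ^ (-w i) := by positivity
    have := hmem y hy s hs1 hs2 hs4 i
    have := hAX i
    push_cast
    nlinarith
  · obtain ⟨hfin, hcard⟩ := finite_and_ncard_le_of_regular hz k hX hAX
    set I := {s : ℕ × (Fin 2 → ℤ) | k * z.1 ≤ s.1 ∧ s.1 < (k + 1) * z.1 ∧
        ∀ i, |(s.1 : ℝ) * ratPoint z i - s.2 i| ≤ A i} with hI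
    have hsub : {y | y ∈ shell τ 0 1 z ∧ ∃ s : ℕ × (Fin 2 → ℤ), k * z.1 ≤ s.1 ∧
        s.1 < (k + 1) * z.1 ∧ ¬ IsMultipleOf s z ∧
        ∀ i, |(s.1 : ℝ) * y i - s.2 i| < (s.1 : ℝ) ^ (-τ i) + e i} ⊆
        ⋃ s ∈ hfin.toFinset, {y : Fin 2 → ℝ | ∀ i, |(s.1 : ℝ) * y i - s.2 i| < 2 * B i} := by
      rintro y ⟨hy, s, hs1, hs2, -, hs4⟩
      simp only [Set.mem_iUnion]
      exact ⟨s, hfin.mem_toFinset.2 ⟨hs1, hs2, hmem y hy s hs1 hs2 hs4⟩,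
        fun i => (hs4 i).trans_le (hθ s.1 hs1 i)⟩
    have heach : ∀ s ∈ hfin.toFinset,
        volume {y : Fin 2 → ℝ | ∀ i, |(s.1 : ℝ) * y i - s.2 i| < 2 * B i} ≤
          ENNReal.ofReal (∏ i, 4 * B i / (k * z.1)) := by
      intro s hs
      have hs' := (hfin.mem_toFinset.1 hs).1
      have hs0 : 0 < s.1 := lt_of_lt_of_le (Nat.mul_pos hk hz.1) hs'
      have hsr : (k : ℝ) * z.1 ≤ s.1 := by exact_mod_cast hs'
      refine (volume_forall_abs_lt_le hs0 _).trans ?_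
      rw [ENNReal.ofReal_prod_of_nonneg (fun i _ => by positivity)]
      refine Finset.prod_le_prod' fun i _ => ENNReal.ofReal_le_ofReal ?_
      have : (0 : ℝ) ≤ B i := by positivity
      rw [← mul_assoc, show (2 * 2 : ℝ) = 4 by norm_num]
      gcongr
    refine (measure_mono hsub).trans ((measure_biUnion_finset_le _ _).trans
      ((Finset.sum_le_card_nsmul _ _ _ heach).trans ?_))
    rw [nsmul_eq_mul, ← ENNReal.ofReal_natCast, ← ENNReal.ofReal_mul (by positivity)]
    refine ENNReal.ofReal_le_ofReal ?_
    rw [← Set.ncard_eq_toFinset_card I hfin]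
    have hprod : ∏ i, 4 * B i / (k * z.1) =
        16 * (∏ i, (z.1 : ℝ) ^ (-(1 + τ i))) * (k : ℝ) ^ (-l) / k ^ 2 := by
      have h1 : (k : ℝ) ^ (-l) = (k : ℝ) ^ (-(l * v 0)) * (k : ℝ) ^ (-(l * v 1)) := by
        rw [← Real.rpow_add hk0]
        rw [Fin.sum_univ_two] at hv1
        congr 1
        linear_combination l * hv1
      rw [h1]
      simp only [Fin.prod_univ_two, hB, neg_add, Real.rpow_add hq, Real.rpow_neg_one]
      field_simp
      norm_num
    rw [hprod]
    have hX2 : (I.ncard : ℝ) ≤ 256 * k ^ 2 * (z.1 : ℝ) ^ (-(2 * d)) := by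
      have h2 : (X + 1) ^ 2 ≤ 4 * X ^ 2 := by nlinarith
      have h3 : X ^ 2 = 64 * k ^ 2 * (z.1 : ℝ) ^ (-(2 * d)) := by
        have : (z.1 : ℝ) ^ (-(2 * d)) = (z.1 : ℝ) ^ (-d) * (z.1 : ℝ) ^ (-d) := by
          rw [← Real.rpow_add hq]; congr 1; ring
        rw [this, hXdef]; ring
      linarith
    calc (I.ncard : ℝ) * (16 * (∏ i, (z.1 : ℝ) ^ (-(1 + τ i))) * (k : ℝ) ^ (-l) / k ^ 2)
        ≤ (256 * k ^ 2 * (z.1 : ℝ) ^ (-(2 * d))) *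
          (16 * (∏ i, (z.1 : ℝ) ^ (-(1 + τ i))) * (k : ℝ) ^ (-l) / k ^ 2) := by
          gcongr
      _ = _ := by field_simp; norm_num

/-- Points of the box around `z` that are close to some rational point with denominator in
`[z.1, N]` that is not `z` itself. -/
def nearOther (τ e : Fin 2 → ℝ) (N : ℝ) (z : ℕ × (Fin 2 → ℤ)) : Set (Fin 2 → ℝ) :=
  {y | y ∈ shell τ 0 1 z ∧ ∃ s : ℕ × (Fin 2 → ℤ), z.1 ≤ s.1 ∧ (s.1 : ℝ) ≤ N ∧
    ¬ IsMultipleOf s z ∧ ∀ i, |(s.1 : ℝ) * y i - s.2 i| < (s.1 : ℝ) ^ (-τ i) + e i}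

theorem volume_nearOther_le {τ v w e : Fin 2 → ℝ} {l d N : ℝ} {z : ℕ × (Fin 2 → ℤ)}
    (hz : IsRegularPoint w z) (hτ : ∀ i, 0 < τ i) (hv : ∀ i, 0 < v i) (hv1 : ∑ i, v i = 1)
    (hl : 1 < l) (hwd : ∀ i, w i + d ≤ τ i) (hlv : ∀ i, l * v i ≤ τ i)
    (he : ∀ (k : ℕ) i, 0 < k → (k : ℝ) * z.1 ≤ N →
      e i ≤ (z.1 : ℝ) ^ (-τ i) * (k : ℝ) ^ (-(l * v i))) :
    volume (nearOther τ e N z) ≤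
      ENNReal.ofReal (4096 * (∑' k : ℕ, (k : ℝ) ^ (-l)) * (z.1 : ℝ) ^ (-(2 * d)) *
        ∏ i, (z.1 : ℝ) ^ (-(1 + τ i))) := by
  have hq : (0 : ℝ) < z.1 := by exact_mod_cast hz.1
  set T := (Finset.range (⌊N⌋₊ + 1)).filter fun k : ℕ => 0 < k ∧ (k : ℝ) * z.1 ≤ N with hT
  have hsub : nearOther τ e N z ⊆ ⋃ k ∈ T, {y | y ∈ shell τ 0 1 z ∧ ∃ s : ℕ × (Fin 2 → ℤ),
      k * z.1 ≤ s.1 ∧ s.1 < (k + 1) * z.1 ∧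
        ¬ IsMultipleOf s z ∧ ∀ i, |(s.1 : ℝ) * y i - s.2 i| < (s.1 : ℝ) ^ (-τ i) + e i} := by
    rintro y ⟨hy, s, hs1, hs2, hs3, hs4⟩
    simp only [Set.mem_iUnion]
    have h1 : s.1 / z.1 * z.1 ≤ s.1 := Nat.div_mul_le_self _ _
    have h2 : s.1 < (s.1 / z.1 + 1) * z.1 := by
      have := Nat.lt_div_mul_add hz.1 (a := s.1)
      linarith
    have h3 : ((s.1 / z.1 : ℕ) : ℝ) * z.1 ≤ N :=
      le_trans (by exact_mod_cast h1) hs2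
    refine ⟨s.1 / z.1, ?_, hy, s, h1, h2, hs3, hs4⟩
    rw [hT, Finset.mem_filter, Finset.mem_range, Nat.lt_succ_iff]
    refine ⟨?_, Nat.div_pos hs1 hz.1, h3⟩
    exact (Nat.div_le_self _ _).trans (Nat.le_floor hs2)
  refine (measure_mono hsub).trans ((measure_biUnion_finset_le _ _).trans
    ((Finset.sum_le_sum fun k hk => volume_shell_block_le hz hτ hv hv1 (by linarith) hwd hlv
      (Finset.mem_filter.1 hk).2.1 fun i => he k i (Finset.mem_filter.1 hk).2.1
        (Finset.mem_filter.1 hk).2.2).trans ?_))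
  rw [← ENNReal.ofReal_sum_of_nonneg (fun k _ => by positivity), ← Finset.mul_sum]
  refine ENNReal.ofReal_le_ofReal ?_
  have hs : ∑ k ∈ T, (k : ℝ) ^ (-l) ≤ ∑' k : ℕ, (k : ℝ) ^ (-l) :=
    (Real.summable_nat_rpow.2 (by linarith)).sum_le_tsum _ fun k _ => by positivity
  calc _ ≤ 4096 * (z.1 : ℝ) ^ (-(2 * d)) * (∏ i, (z.1 : ℝ) ^ (-(1 + τ i))) *
        ∑' k : ℕ, (k : ℝ) ^ (-l) := by gcongr
    _ = _ := by ring

/-- Compatibility conditions between the exponents `τ` of the target set, the weights `v` used in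
Dirichlet's theorem, the regularity weights `w`, and the small loss `η`. -/
structure IsAdmissible (τ v w : Fin 2 → ℝ) (η : ℝ) : Prop where
  v_pos : ∀ i, 0 < v i
  v_sum : ∑ i, v i = 1
  eta_pos : 0 < η
  eta_lt : η < 1
  v_le : ∀ i, v i ≤ (1 - η) * w i
  w_lt : ∀ i, w i + η * (1 + τ i) < τ i
  lv_le : ∀ i, (1 + η / 2) * v i ≤ τ i

/-- The denominator bound `Q` is large compared with the denominator `q`. -/
structure IsLargeScale (τ v w : Fin 2 → ℝ) (η : ℝ) (q Q : ℕ) : Prop where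
  le_inner : ∀ i, 48 * (Q : ℝ) ^ (-(v i * η / 2)) ≤ (q : ℝ) ^ (-(1 + τ i))
  le_rpow : (q : ℝ) ≤ (Q : ℝ) ^ (1 - η)
  lt_rpow : ∀ i, 2 * (Q : ℝ) ^ η * ((Q : ℝ) ^ (1 - η)) ^ (-τ i) < (Q : ℝ) ^ (-w i)

section Admissible

variable {τ v w : Fin 2 → ℝ} {η : ℝ}

namespace IsAdmissible

theorem w_pos (h : IsAdmissible τ v w η) (i : Fin 2) : 0 < w i := by
  have h1 := h.v_pos i
  have h2 := h.v_le i
  have h3 := h.eta_lt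
  by_contra! hw
  nlinarith

theorem tau_pos (h : IsAdmissible τ v w η) (i : Fin 2) : 0 < τ i := by
  have h1 := h.v_pos i
  have h2 := h.lv_le i
  have h3 := h.eta_pos
  nlinarith

theorem w_lt_tau (h : IsAdmissible τ v w η) (i : Fin 2) : w i < τ i := by
  have h1 := h.tau_pos i
  have h2 := h.w_lt i
  have h3 := h.eta_pos
  nlinarith

theorem w_add_eta_le (h : IsAdmissible τ v w η) (i : Fin 2) : w i + η ≤ τ i := by
  have h1 := h.tau_pos i
  have h2 := h.w_lt i
  have h3 := h.eta_pos
  nlinarith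

end IsAdmissible

theorem mul_rpow_le_abs_of_isMultipleOf {α β : ℝ} (hα : 0 ≤ α) {a s : ℕ × (Fin 2 → ℤ)}
    (ha : 0 < a.1) (hs : 0 < s.1) (hsa : IsMultipleOf s a) {y : Fin 2 → ℝ}
    (hy : y ∈ shell τ α β a) (i : Fin 2) :
    α * (a.1 : ℝ) ^ (-τ i) ≤ |(s.1 : ℝ) * y i - s.2 i| := by
  obtain ⟨k, hk, hkp⟩ := hsa
  have hq : (0 : ℝ) < a.1 := by exact_mod_cast ha
  have hk0 : 0 < k := by
    have h1 : (0 : ℤ) < k * a.1 := by rw [← hk]; exact_mod_cast hs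
    exact pos_of_mul_pos_left h1 (by positivity)
  have hk1 : (1 : ℝ) ≤ k := by exact_mod_cast hk0
  have hkr : (s.1 : ℝ) = k * a.1 := by exact_mod_cast hk
  have h1 : α * (a.1 : ℝ) ^ (-τ i) ≤ a.1 * (y i - ratPoint a i) := by
    have h2 := hy.1 i
    have h3 : (a.1 : ℝ) ^ (-τ i) = a.1 * (a.1 : ℝ) ^ (-(1 + τ i)) := by
      rw [neg_add, Real.rpow_add hq, Real.rpow_neg_one]
      field_simp
    rw [h3]
    have : α * (a.1 : ℝ) ^ (-(1 + τ i)) ≤ y i - ratPoint a i := by simp only at h2; linarith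
    nlinarith
  have h2 : (s.1 : ℝ) * y i - s.2 i = k * (a.1 * (y i - ratPoint a i)) := by
    rw [hkr, hkp i]
    simp only [ratPoint]
    push_cast
    field_simp
  have h3 : 0 ≤ α * (a.1 : ℝ) ^ (-τ i) := by positivity
  rw [h2, abs_of_nonneg (mul_nonneg (by linarith) (h3.trans h1))]
  nlinarith

section Scale

variable {Q : ℕ} {a : ℕ × (Fin 2 → ℤ)}

theorem IsLargeScale.one_le (h : IsAdmissible τ v w η) (ha : 0 < a.1)
    (hQ : IsLargeScale τ v w η a.1 Q) : 1 ≤ Q := by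
  rcases Nat.eq_zero_or_pos Q with rfl | h'
  · have h1 := hQ.le_rpow
    have h2 : (1 : ℝ) ≤ a.1 := by exact_mod_cast ha
    rw [Nat.cast_zero, Real.zero_rpow (by linarith [h.eta_lt])] at h1
    linarith
  · exact h'

theorem IsLargeScale.mul_rpow_le (h : IsAdmissible τ v w η) (ha : 0 < a.1)
    (hQ : IsLargeScale τ v w η a.1 Q) (i : Fin 2) :
    48 * (Q : ℝ) ^ (-v i) ≤ (a.1 : ℝ) ^ (-(1 + τ i)) := by
  have hQ1 : (1 : ℝ) ≤ Q := by exact_mod_cast hQ.one_le h ha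
  refine le_trans ?_ (hQ.le_inner i)
  gcongr
  have := h.v_pos i
  have := h.eta_lt
  nlinarith

theorem rpow_neg_one_add_le (ha : 0 < a.1) (i : Fin 2) :
    (a.1 : ℝ) ^ (-(1 + τ i)) ≤ (a.1 : ℝ) ^ (-τ i) := by
  have h1 : (1 : ℝ) ≤ a.1 := by exact_mod_cast ha
  exact Real.rpow_le_rpow_of_exponent_le h1 (by linarith)

theorem IsLargeScale.mul_rpow_le_mul (h : IsAdmissible τ v w η) (ha : 0 < a.1)
    (hQ : IsLargeScale τ v w η a.1 Q) (k : ℕ) (i : Fin 2) (hk : 0 < k)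
    (hkN : (k : ℝ) * a.1 ≤ (Q : ℝ) ^ (1 - η)) :
    3 * (Q : ℝ) ^ (-v i) ≤ (a.1 : ℝ) ^ (-τ i) * (k : ℝ) ^ (-((1 + η / 2) * v i)) := by
  have hQ1 : (1 : ℝ) ≤ Q := by exact_mod_cast hQ.one_le h ha
  have ha1 : (1 : ℝ) ≤ a.1 := by exact_mod_cast ha
  have hk1 : (1 : ℝ) ≤ k := by exact_mod_cast hk
  have hv := h.v_pos i
  have hη := h.eta_pos
  have hη1 := h.eta_lt
  have h1 : (k : ℝ) ≤ (Q : ℝ) ^ (1 - η) := by nlinarith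
  have h2 : ((Q : ℝ) ^ (1 - η)) ^ (-((1 + η / 2) * v i)) ≤ (k : ℝ) ^ (-((1 + η / 2) * v i)) :=
    Real.rpow_le_rpow_of_nonpos (by linarith) h1 (by nlinarith)
  rw [← Real.rpow_mul (by linarith)] at h2
  have h3 : (Q : ℝ) ^ (-(v i) + v i * η / 2) ≤
      (Q : ℝ) ^ ((1 - η) * (-((1 + η / 2) * v i))) :=
    Real.rpow_le_rpow_of_exponent_le hQ1 (by nlinarith [mul_pos hv (mul_pos hη hη)])
  have h4 := (hQ.le_inner i).trans (rpow_neg_one_add_le ha i)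
  have h5 : (Q : ℝ) ^ (-v i) = (Q : ℝ) ^ (-(v i * η / 2)) * (Q : ℝ) ^ (-(v i) + v i * η / 2) := by
    rw [← Real.rpow_add (by linarith)]
    congr 1
    ring
  have h6 : (0 : ℝ) < (Q : ℝ) ^ (-(v i * η / 2)) := by positivity
  rw [h5, ← mul_assoc]
  refine mul_le_mul ?_ (h3.trans h2) (by positivity) (by positivity)
  linarith

/-- No rational point with denominator at most `Q ^ (1 - η)` is too close to a point that is near
`a` and not near any other rational point. -/
theorem not_approx_of_notMem_nearOther (h : IsAdmissible τ v w η) (ha : IsRegularPoint w a)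
    (hQ : IsLargeScale τ v w η a.1 Q) {y : Fin 2 → ℝ} (hy : y ∈ shell τ (9 / 16) (11 / 16) a)
    (hy0 : y ∉ nearOther τ (fun i => 3 * (Q : ℝ) ^ (-v i)) ((Q : ℝ) ^ (1 - η)) a)
    {s : ℕ × (Fin 2 → ℤ)} (hs : 0 < s.1) (hsN : (s.1 : ℝ) ≤ (Q : ℝ) ^ (1 - η))
    {c : ℝ} (hc : c ≤ 1 / 4) (hca : s.1 < a.1 → c ≤ 0) :
    ¬ ∀ i, |(s.1 : ℝ) * y i - s.2 i| < c * (s.1 : ℝ) ^ (-τ i) + 3 * (Q : ℝ) ^ (-v i) := by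
  intro hall
  have ha1 : (1 : ℝ) ≤ a.1 := by exact_mod_cast ha.1
  have ha0 : (0 : ℝ) < a.1 := by linarith
  have hs0 : (0 : ℝ) < s.1 := by exact_mod_cast hs
  have hyb : ∀ i, 0 ≤ y i - ratPoint a i ∧
      y i - ratPoint a i ≤ 11 / 16 * (a.1 : ℝ) ^ (-(1 + τ i)) := fun i => by
    have h1 := hy.1 i
    have h2 := hy.2 i
    simp only at h1 h2
    have : (0 : ℝ) < (a.1 : ℝ) ^ (-(1 + τ i)) := by positivity
    constructor <;> linarith
  have hsmall : ∀ i, 48 * (Q : ℝ) ^ (-v i) ≤ (a.1 : ℝ) ^ (-τ i) := fun i =>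
    (hQ.mul_rpow_le h ha.1 i).trans (rpow_neg_one_add_le ha.1 i)
  rcases lt_or_ge s.1 a.1 with hlt | hge
  · have hlt' : (s.1 : ℝ) < a.1 := by exact_mod_cast hlt
    obtain ⟨k, hk, -⟩ := ha.2 s.1 s.2 fun i => by
      have h1 := hall i
      have h2 : c * (s.1 : ℝ) ^ (-τ i) ≤ 0 :=
        mul_nonpos_of_nonpos_of_nonneg (hca hlt) (by positivity)
      have h3 : |(s.1 : ℝ) * (y i - ratPoint a i)| ≤ 11 / 16 * (a.1 : ℝ) ^ (-τ i) := by
        rw [abs_of_nonneg (mul_nonneg hs0.le (hyb i).1)]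
        calc (s.1 : ℝ) * (y i - ratPoint a i) ≤
              a.1 * (11 / 16 * (a.1 : ℝ) ^ (-(1 + τ i))) := by
              gcongr
              · exact (hyb i).1
              · exact (hyb i).2
          _ = 11 / 16 * (a.1 : ℝ) ^ (-τ i) := by
            rw [neg_add, Real.rpow_add ha0, Real.rpow_neg_one]
            field_simp
      have h4 : (a.1 : ℝ) ^ (-τ i) ≤ (a.1 : ℝ) ^ (-w i) :=
        Real.rpow_le_rpow_of_exponent_le ha1 (by linarith [h.w_lt_tau i])
      have h5 := hsmall i
      have h6 : (0 : ℝ) < (a.1 : ℝ) ^ (-τ i) := by positivity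
      have h7 : ((s.1 : ℤ) : ℝ) * ratPoint a i - s.2 i =
        ((s.1 : ℝ) * y i - s.2 i) - (s.1 : ℝ) * (y i - ratPoint a i) := by push_cast; ring
      rw [h7]
      refine (abs_sub _ _).trans_lt ?_
      linarith
    have hk0 : 0 < k := by
      have h1 : (0 : ℤ) < k * a.1 := by rw [← hk]; exact_mod_cast hs
      exact pos_of_mul_pos_left h1 (by positivity)
    have : (s.1 : ℤ) < a.1 := by exact_mod_cast hlt
    nlinarith
  · have hsτ : ∀ i, (s.1 : ℝ) ^ (-τ i) ≤ (a.1 : ℝ) ^ (-τ i) := fun i =>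
      Real.rpow_le_rpow_of_nonpos ha0 (by exact_mod_cast hge) (by linarith [h.tau_pos i])
    by_cases hm : IsMultipleOf s a
    · have h1 := mul_rpow_le_abs_of_isMultipleOf (by norm_num) ha.1 hs hm hy 0
      have h2 := hall 0
      have h3 := hsmall 0
      have h4 := hsτ 0
      have h5 : (0 : ℝ) < (s.1 : ℝ) ^ (-τ 0) := by positivity
      nlinarith
    · refine hy0 ⟨⟨fun i => ?_, fun i => ?_⟩, s, hge, hsN, hm, fun i => (hall i).trans_le ?_⟩
      · have := hyb i
        simp only
        linarith
      · have := hyb i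
        have : (0 : ℝ) < (a.1 : ℝ) ^ (-(1 + τ i)) := by positivity
        simp only
        linarith
      · have h5 : (0 : ℝ) < (s.1 : ℝ) ^ (-τ i) := by positivity
        simp only
        nlinarith

/-- A point of the inner box around `z` stays close to any `y` approximated by `z`. -/
theorem abs_sub_le_of_mem_shell (h : IsAdmissible τ v w η) (hQ1 : (1 : ℝ) ≤ Q)
    {z : ℕ × (Fin 2 → ℤ)} (hzN : (Q : ℝ) ^ (1 - η) ≤ z.1) {y x : Fin 2 → ℝ} {i : Fin 2}
    (hzy : |(z.1 : ℝ) * y i - z.2 i| ≤ 2 * (Q : ℝ) ^ (-v i))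
    (hx : x ∈ shell τ (1 / 2) (3 / 4) z) :
    z.1 * |x i - y i| ≤ 3 * (Q : ℝ) ^ (-v i) := by
  have hN1 : (1 : ℝ) ≤ (Q : ℝ) ^ (1 - η) := Real.one_le_rpow hQ1 (by linarith [h.eta_lt])
  have hz1 : (1 : ℝ) ≤ z.1 := hN1.trans hzN
  have hz0 : (0 : ℝ) < z.1 := by linarith
  have h1 : |(z.1 : ℝ) * (x i - ratPoint z i)| ≤ (z.1 : ℝ) ^ (-τ i) := by
    have h2 := hx.1 i
    have h3 := hx.2 i
    simp only at h2 h3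
    have h4 : (0 : ℝ) < (z.1 : ℝ) ^ (-(1 + τ i)) := by positivity
    rw [abs_of_nonneg (mul_nonneg hz0.le (by linarith))]
    calc (z.1 : ℝ) * (x i - ratPoint z i) ≤ z.1 * (z.1 : ℝ) ^ (-(1 + τ i)) := by
          gcongr
          linarith
      _ = (z.1 : ℝ) ^ (-τ i) := by
          rw [neg_add, Real.rpow_add hz0, Real.rpow_neg_one]
          field_simp
  have h2 : (z.1 : ℝ) ^ (-τ i) ≤ (Q : ℝ) ^ (-v i) := by
    calc (z.1 : ℝ) ^ (-τ i) ≤ (z.1 : ℝ) ^ (-w i) :=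
          Real.rpow_le_rpow_of_exponent_le hz1 (by linarith [h.w_lt_tau i])
      _ ≤ ((Q : ℝ) ^ (1 - η)) ^ (-w i) :=
          Real.rpow_le_rpow_of_nonpos (by linarith) hzN (by linarith [h.w_pos i])
      _ = (Q : ℝ) ^ ((1 - η) * (-w i)) := (Real.rpow_mul (by linarith) _ _).symm
      _ ≤ (Q : ℝ) ^ (-v i) :=
          Real.rpow_le_rpow_of_exponent_le hQ1 (by linarith [h.v_le i])
  have h3 : (z.1 : ℝ) * (x i - y i) =
      z.1 * (x i - ratPoint z i) - ((z.1 : ℝ) * y i - z.2 i) := by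
    simp only [ratPoint]
    field_simp
    ring
  calc (z.1 : ℝ) * |x i - y i| = |(z.1 : ℝ) * (x i - y i)| := by
        rw [abs_mul, abs_of_pos hz0]
    _ ≤ _ := by
      rw [h3]
      exact (abs_sub _ _).trans (by linarith)

theorem shell_subset_shell (h : IsAdmissible τ v w η) (ha : IsRegularPoint w a)
    (hQ : IsLargeScale τ v w η a.1 Q) {y : Fin 2 → ℝ} (hy : y ∈ shell τ (9 / 16) (11 / 16) a)
    {z : ℕ × (Fin 2 → ℤ)} (hzN : (Q : ℝ) ^ (1 - η) ≤ z.1)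
    (hzy : ∀ i, |(z.1 : ℝ) * y i - z.2 i| ≤ 2 * (Q : ℝ) ^ (-v i)) :
    shell τ (1 / 2) (3 / 4) z ⊆ shell τ (1 / 2) (3 / 4) a := by
  intro x hx
  have hQ1 : (1 : ℝ) ≤ Q := by exact_mod_cast hQ.one_le h ha.1
  have key : ∀ i, |x i - y i| ≤ 1 / 16 * (a.1 : ℝ) ^ (-(1 + τ i)) := fun i => by
    have h1 := abs_sub_le_of_mem_shell h hQ1 hzN (hzy i) hx
    have h2 := hQ.mul_rpow_le h ha.1 i
    have h3 : (1 : ℝ) ≤ z.1 :=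
      (Real.one_le_rpow hQ1 (by linarith [h.eta_lt] : (0 : ℝ) ≤ 1 - η)).trans hzN
    nlinarith [abs_nonneg (x i - y i)]
  refine ⟨fun i => ?_, fun i => ?_⟩
  · have h1 := (abs_le.1 (key i)).1
    have h2 := hy.1 i
    simp only at h2 ⊢
    linarith
  · have h1 := (abs_le.1 (key i)).2
    have h2 := hy.2 i
    simp only at h2 ⊢
    linarith

theorem not_approx_of_mem_shell (h : IsAdmissible τ v w η) (ha : IsRegularPoint w a)
    (hQ : IsLargeScale τ v w η a.1 Q) {y : Fin 2 → ℝ} (hy : y ∈ shell τ (9 / 16) (11 / 16) a)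
    (hy0 : y ∉ nearOther τ (fun i => 3 * (Q : ℝ) ^ (-v i)) ((Q : ℝ) ^ (1 - η)) a)
    {z : ℕ × (Fin 2 → ℤ)} (hz : IsRegularPoint w z) (hzN : (Q : ℝ) ^ (1 - η) ≤ z.1)
    (hzQ : z.1 ≤ Q) (hzy : ∀ i, |(z.1 : ℝ) * y i - z.2 i| ≤ 2 * (Q : ℝ) ^ (-v i))
    {x : Fin 2 → ℝ} (hx : x ∈ shell τ (1 / 2) (3 / 4) z) {q : ℕ} (hq : a.1 ≤ q) (hqQ : q < Q)
    (p : Fin 2 → ℤ) : ¬ ∀ i, |(q : ℝ) * x i - p i| < 1 / 4 * (q : ℝ) ^ (-τ i) := by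
  intro hall
  have hQ1 : (1 : ℝ) ≤ Q := by exact_mod_cast hQ.one_le h ha.1
  have hQ0 : (0 : ℝ) < Q := by linarith
  have hqpos : 0 < q := lt_of_lt_of_le ha.1 hq
  have hq0 : (0 : ℝ) < q := by exact_mod_cast hqpos
  have hN1 : (1 : ℝ) ≤ (Q : ℝ) ^ (1 - η) := Real.one_le_rpow hQ1 (by linarith [h.eta_lt])
  have hz0 : (0 : ℝ) < z.1 := by linarith
  rcases le_or_gt (q : ℝ) ((Q : ℝ) ^ (1 - η)) with hqN | hqN
  · refine not_approx_of_notMem_nearOther h ha hQ hy hy0 (s := (q, p)) hqpos hqN le_rfl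
      (fun hlt => absurd hlt (not_lt.2 hq)) fun i => ?_
    have h1 := abs_sub_le_of_mem_shell h hQ1 hzN (hzy i) hx
    have h2 : (q : ℝ) * |x i - y i| ≤ z.1 * |x i - y i| := by
      gcongr
      exact_mod_cast hqN.trans hzN
    have h3 : (q : ℝ) * y i - p i = ((q : ℝ) * x i - p i) - q * (x i - y i) := by ring
    simp only
    rw [h3]
    refine (abs_sub _ _).trans_lt ?_
    rw [abs_mul, abs_of_pos hq0]
    linarith [hall i]
  · have hqz : ∀ i, (z.1 : ℝ) ^ (-τ i) ≤ ((Q : ℝ) ^ (1 - η)) ^ (-τ i) := fun i =>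
      Real.rpow_le_rpow_of_nonpos (by linarith) hzN (by linarith [h.tau_pos i])
    obtain ⟨k, hk, hkp⟩ := hz.2 q p fun i => by
      have h1 := hx.1 i
      have h2 := hx.2 i
      simp only at h1 h2
      have h3 : (0 : ℝ) < (z.1 : ℝ) ^ (-(1 + τ i)) := by positivity
      have h4 : |(q : ℝ) * (x i - ratPoint z i)| ≤
          3 / 4 * ((Q : ℝ) ^ η * ((Q : ℝ) ^ (1 - η)) ^ (-τ i)) := by
        rw [abs_of_nonneg (mul_nonneg hq0.le (by linarith))]
        have h5 : (Q : ℝ) = (Q : ℝ) ^ η * (Q : ℝ) ^ (1 - η) := by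
          rw [← Real.rpow_add hQ0]
          simp
        calc (q : ℝ) * (x i - ratPoint z i) ≤ Q * (3 / 4 * (z.1 : ℝ) ^ (-(1 + τ i))) := by
              gcongr
              · linarith
              · linarith
          _ = (Q : ℝ) ^ η * (Q : ℝ) ^ (1 - η) * (3 / 4 * (z.1 : ℝ) ^ (-(1 + τ i))) := by
              rw [← h5]
          _ ≤ (Q : ℝ) ^ η * z.1 * (3 / 4 * (z.1 : ℝ) ^ (-(1 + τ i))) := by gcongr
          _ = 3 / 4 * ((Q : ℝ) ^ η * (z.1 : ℝ) ^ (-τ i)) := by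
              rw [neg_add, Real.rpow_add hz0, Real.rpow_neg_one]
              field_simp
          _ ≤ _ := by
              have := hqz i
              gcongr
      have h6 : (q : ℝ) ^ (-τ i) ≤ ((Q : ℝ) ^ (1 - η)) ^ (-τ i) :=
        Real.rpow_le_rpow_of_nonpos (by linarith) hqN.le (by linarith [h.tau_pos i])
      have h7 : (1 : ℝ) ≤ (Q : ℝ) ^ η := Real.one_le_rpow hQ1 h.eta_pos.le
      have h8 : (0 : ℝ) < ((Q : ℝ) ^ (1 - η)) ^ (-τ i) := by positivity
      have h9 : (Q : ℝ) ^ (-w i) ≤ (z.1 : ℝ) ^ (-w i) :=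
        Real.rpow_le_rpow_of_nonpos hz0 (by exact_mod_cast hzQ) (by linarith [h.w_pos i])
      have h10 := hQ.lt_rpow i
      have h11 : ((q : ℤ) : ℝ) * ratPoint z i - p i =
        ((q : ℝ) * x i - p i) - (q : ℝ) * (x i - ratPoint z i) := by push_cast; ring
      rw [h11]
      refine (abs_sub _ _).trans_lt ?_
      nlinarith [hall i]
    have h1 := mul_rpow_le_abs_of_isMultipleOf (by norm_num) hz.1 (s := (q, p)) hqpos
      ⟨k, hk, hkp⟩ hx 0
    have hzq : z.1 ≤ q := by
      have hk0 : 0 < k := by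
        have h1 : (0 : ℤ) < k * z.1 := by rw [← hk]; exact_mod_cast hqpos
        exact pos_of_mul_pos_left h1 (by positivity)
      have h2 : (0 : ℤ) < z.1 := by exact_mod_cast hz.1
      have : (z.1 : ℤ) ≤ q := by rw [hk]; nlinarith
      exact_mod_cast this
    have h2 : (q : ℝ) ^ (-τ 0) ≤ (z.1 : ℝ) ^ (-τ 0) :=
      Real.rpow_le_rpow_of_nonpos hz0 (by exact_mod_cast hzq) (by linarith [h.tau_pos 0])
    have h3 := hall 0
    have h4 : (0 : ℝ) < (q : ℝ) ^ (-τ 0) := by positivity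
    simp only at h1
    linarith

end Scale

theorem exists_measurable_selection {X S : Type*} [MeasurableSpace X] [MeasurableSpace S]
    [Countable S] [Nonempty S] {A : S → Set X} (hA : ∀ z, MeasurableSet (A z)) :
    ∃ f : X → S, Measurable f ∧ ∀ x ∈ ⋃ z, A z, x ∈ A (f x) := by
  classical
  obtain ⟨g, hg⟩ := exists_surjective_nat S
  have hex : ∀ x, ∃ n, x ∈ A (g n) ∨ x ∉ ⋃ z, A z := fun x => by
    by_cases hx : x ∈ ⋃ z, A z
    · obtain ⟨z, hz⟩ := Set.mem_iUnion.1 hx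
      obtain ⟨n, rfl⟩ := hg z
      exact ⟨n, Or.inl hz⟩
    · exact ⟨0, Or.inr hx⟩
  have hm : Measurable fun x => Nat.find (hex x) :=
    measurable_find hex fun n => (hA (g n)).union (MeasurableSet.iUnion hA).compl
  refine ⟨fun x => g (Nat.find (hex x)), measurable_from_nat.comp hm, fun x hx => ?_⟩
  exact (Nat.find_spec (hex x)).resolve_right (not_not.2 hx)

theorem measurableSet_nearOther (τ e : Fin 2 → ℝ) (N : ℝ) (z : ℕ × (Fin 2 → ℤ)) :
    MeasurableSet (nearOther τ e N z) := by
  have h : nearOther τ e N z = shell τ 0 1 z ∩ ⋃ s : ℕ × (Fin 2 → ℤ),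
      ⋃ _ : z.1 ≤ s.1 ∧ (s.1 : ℝ) ≤ N ∧ ¬ IsMultipleOf s z, ⋂ i, {y : Fin 2 → ℝ |
        |(s.1 : ℝ) * y i - s.2 i| < (s.1 : ℝ) ^ (-τ i) + e i} := by
    ext y
    simp only [nearOther, mem_ofPred_eq, mem_inter_iff, mem_iUnion, mem_iInter, exists_prop,
      and_assoc]
  rw [h]
  refine measurableSet_Icc.inter (MeasurableSet.iUnion fun s => MeasurableSet.iUnion fun _ =>
    MeasurableSet.iInter fun i => ?_)
  exact measurableSet_lt (by fun_prop) measurable_const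

theorem volume_shell (τ : Fin 2 → ℝ) (α β : ℝ) (z : ℕ × (Fin 2 → ℤ)) :
    volume (shell τ α β z) = ∏ i, ENNReal.ofReal ((β - α) * (z.1 : ℝ) ^ (-(1 + τ i))) := by
  rw [shell, Real.volume_Icc_pi]
  refine Finset.prod_congr rfl fun i _ => ?_
  congr 1
  ring

variable {Q : ℕ} {a : ℕ × (Fin 2 → ℤ)}

theorem ofReal_le_volume_diff_nearOther (h : IsAdmissible τ v w η) (ha : IsRegularPoint w a)
    (hQ : IsLargeScale τ v w η a.1 Q)
    (ha0 : 4096 * (∑' k : ℕ, (k : ℝ) ^ (-(1 + η / 2))) * (a.1 : ℝ) ^ (-(2 * η)) ≤ 1 / 128) :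
    ENNReal.ofReal (1 / 128 * ∏ i, (a.1 : ℝ) ^ (-(1 + τ i))) ≤
      volume (shell τ (9 / 16) (11 / 16) a \
        nearOther τ (fun i => 3 * (Q : ℝ) ^ (-v i)) ((Q : ℝ) ^ (1 - η)) a) := by
  have hq : (0 : ℝ) < a.1 := by exact_mod_cast ha.1
  have hbad : volume (nearOther τ (fun i => 3 * (Q : ℝ) ^ (-v i)) ((Q : ℝ) ^ (1 - η)) a) ≤
      ENNReal.ofReal (1 / 128 * ∏ i, (a.1 : ℝ) ^ (-(1 + τ i))) := by
    refine (volume_nearOther_le ha h.tau_pos h.v_pos h.v_sum (l := 1 + η / 2)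
      (by linarith [h.eta_pos]) h.w_add_eta_le h.lv_le
      fun k i hk hkN => hQ.mul_rpow_le_mul h ha.1 k i hk hkN).trans ?_
    refine ENNReal.ofReal_le_ofReal ?_
    gcongr
  refine le_trans ?_ le_measure_sdiff
  refine le_trans ?_ (tsub_le_tsub_left hbad _)
  rw [volume_shell, ← ENNReal.ofReal_prod_of_nonneg (fun i _ => by positivity),
    ← ENNReal.ofReal_sub _ (by positivity)]
  refine ENNReal.ofReal_le_ofReal (le_of_eq ?_)
  simp only [Fin.prod_univ_two]
  ring

theorem volume_shell_inter_Icc_le {α β : ℝ} (hαβ : α < β) (ha : 0 < a.1) (y δ : Fin 2 → ℝ)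
    (hδ : ∀ i, 0 ≤ δ i) :
    volume (shell τ α β a ∩ Icc (y - δ) (y + δ)) ≤
      ENNReal.ofReal (∏ i, ((β - α) * (a.1 : ℝ) ^ (-(1 + τ i)) *
        min 1 (2 / (β - α) * (a.1 : ℝ) ^ (1 + τ i) * δ i))) := by
  have hq : (0 : ℝ) < a.1 := by exact_mod_cast ha
  have hd : 0 < β - α := by linarith
  rw [shell, Set.Icc_inter_Icc, Real.volume_Icc_pi, ENNReal.ofReal_prod_of_nonneg
    (fun i _ => mul_nonneg (by positivity)
      (le_min (by norm_num) (mul_nonneg (by positivity) (hδ i))))]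
  refine Finset.prod_le_prod' fun i _ => ENNReal.ofReal_le_ofReal ?_
  have h1 : (a.1 : ℝ) ^ (-(1 + τ i)) * (a.1 : ℝ) ^ (1 + τ i) = 1 := by
    rw [← Real.rpow_add hq]
    simp
  rw [mul_min_of_nonneg _ _ (by positivity), mul_one]
  have h2 : (β - α) * (a.1 : ℝ) ^ (-(1 + τ i)) * (2 / (β - α) * (a.1 : ℝ) ^ (1 + τ i) * δ i) =
      2 * δ i := by
    calc _ = (β - α) / (β - α) * ((a.1 : ℝ) ^ (-(1 + τ i)) * (a.1 : ℝ) ^ (1 + τ i)) *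
          (2 * δ i) := by ring
      _ = _ := by rw [h1, div_self hd.ne']; ring
  rw [h2]
  simp only [Pi.sup_apply, Pi.inf_apply, Pi.sub_apply, Pi.add_apply]
  refine le_min ?_ ?_
  · have h3 := inf_le_left (a := ratPoint a i + β * (a.1 : ℝ) ^ (-(1 + τ i))) (b := y i + δ i)
    have h4 := le_sup_left (a := ratPoint a i + α * (a.1 : ℝ) ^ (-(1 + τ i))) (b := y i - δ i)
    linarith
  · have h3 := inf_le_right (a := ratPoint a i + β * (a.1 : ℝ) ^ (-(1 + τ i))) (b := y i + δ i)
    have h4 := le_sup_right (a := ratPoint a i + α * (a.1 : ℝ) ^ (-(1 + τ i))) (b := y i - δ i)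
    linarith

/-- A random descendant of `a`: a regular rational point of denominator at most `Q`, whose box is
contained in that of `a` and avoids all intermediate rational points. -/
theorem exists_descendant_measure (h : IsAdmissible τ v w η) (ha : IsRegularPoint w a)
    (hQ : IsLargeScale τ v w η a.1 Q)
    (ha0 : 4096 * (∑' k : ℕ, (k : ℝ) ^ (-(1 + η / 2))) * (a.1 : ℝ) ^ (-(2 * η)) ≤ 1 / 128) :
    ∃ κ : Measure (ℕ × (Fin 2 → ℤ)), IsProbabilityMeasure κ ∧
      (∀ᵐ z ∂κ, IsRegularPoint w z ∧ (Q : ℝ) ^ (1 - η) ≤ z.1 ∧ z.1 ≤ Q ∧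
        shell τ (1 / 2) (3 / 4) z ⊆ shell τ (1 / 2) (3 / 4) a ∧
        ∀ x ∈ shell τ (1 / 2) (3 / 4) z, ∀ q : ℕ, a.1 ≤ q → q < Q → ∀ p : Fin 2 → ℤ,
          ¬ ∀ i, |(q : ℝ) * x i - p i| < 1 / 4 * (q : ℝ) ^ (-τ i)) ∧
      ∀ (y : Fin 2 → ℝ) (t : ℝ), 0 ≤ t →
        κ {z | (shell τ (1 / 2) (3 / 4) z ∩ Metric.ball y t).Nonempty} ≤
          ENNReal.ofReal (2 * ∏ i, min 1 (16 * (a.1 : ℝ) ^ (1 + τ i) *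
            (t + 3 * (Q : ℝ) ^ (-(1 + v i - η))))) := by
  have hQ1 : (1 : ℝ) ≤ Q := by exact_mod_cast hQ.one_le h ha.1
  have hQ0 : (0 : ℝ) < Q := by linarith
  have hq0 : (0 : ℝ) < a.1 := by exact_mod_cast ha.1
  have hN1 : (1 : ℝ) ≤ (Q : ℝ) ^ (1 - η) := Real.one_le_rpow hQ1 (by linarith [h.eta_lt])
  set G := shell τ (9 / 16) (11 / 16) a \
    nearOther τ (fun i => 3 * (Q : ℝ) ^ (-v i)) ((Q : ℝ) ^ (1 - η)) a with hG
  have hGm : MeasurableSet G := measurableSet_Icc.diff (measurableSet_nearOther _ _ _ _)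
  have hGvol := ofReal_le_volume_diff_nearOther h ha hQ ha0
  rw [← hG] at hGvol
  have hG0 : volume G ≠ 0 := fun h0 => by
    rw [h0, nonpos_iff_eq_zero, ENNReal.ofReal_eq_zero] at hGvol
    exact absurd hGvol (not_le.2 (by positivity))
  have hGtop : volume G ≠ ⊤ := ((measure_mono sdiff_subset).trans_lt
    (by rw [volume_shell]; exact ENNReal.prod_lt_top fun i _ => ENNReal.ofReal_lt_top)).ne
  let A : ℕ × (Fin 2 → ℤ) → Set (Fin 2 → ℝ) := fun z =>
    {y | (IsRegularPoint w z ∧ (Q : ℝ) ^ (1 - η) ≤ z.1 ∧ z.1 ≤ Q) ∧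
      ∀ i, |(z.1 : ℝ) * y i - z.2 i| ≤ 2 * (Q : ℝ) ^ (-v i)}
  have hA : ∀ z, MeasurableSet (A z) := fun z => by
    refine (MeasurableSet.const _).inter ?_
    change MeasurableSet {y : Fin 2 → ℝ | ∀ i, |(z.1 : ℝ) * y i - z.2 i| ≤ 2 * (Q : ℝ) ^ (-v i)}
    rw [Set.ofPred_forall]
    exact MeasurableSet.iInter fun i => measurableSet_le (by fun_prop) measurable_const
  have hGA : G ⊆ ⋃ z, A z := by
    intro y hy
    obtain ⟨z, hz, hzN, hzQ, hzy⟩ := exists_regular_of_forall_not_approx (y := y) h.v_pos h.v_sum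
      h.w_pos (hQ.one_le h ha.1) hN1 (fun i => by
        rw [← Real.rpow_mul hQ0.le]
        exact Real.rpow_le_rpow_of_exponent_le hQ1 (by linarith [h.v_le i]))
      (fun b hb hbN p hp => not_approx_of_notMem_nearOther h ha hQ hy.1 hy.2 (s := (b, p)) hb hbN
        (c := 0) (by norm_num) (fun _ => le_rfl) fun i => by
          have : (0 : ℝ) < (Q : ℝ) ^ (-v i) := by positivity
          simp only
          linarith [hp i])
    exact Set.mem_iUnion.2 ⟨z, ⟨hz, hzN.le, hzQ⟩, hzy⟩
  obtain ⟨f, hf, hfA⟩ := exists_measurable_selection hA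
  have : IsProbabilityMeasure (ProbabilityTheory.cond volume G) :=
    ProbabilityTheory.cond_isProbabilityMeasure_of_finite hG0 hGtop
  refine ⟨(ProbabilityTheory.cond volume G).map f,
    Measure.isProbabilityMeasure_map hf.aemeasurable, ?_, ?_⟩
  · rw [ae_map_iff hf.aemeasurable (MeasurableSet.of_discrete)]
    filter_upwards [ProbabilityTheory.ae_cond_mem hGm] with y hy
    obtain ⟨⟨hz, hzN, hzQ⟩, hzy⟩ := hfA y (hGA hy)
    exact ⟨hz, hzN, hzQ, shell_subset_shell h ha hQ hy.1 hzN hzy,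
      fun x hx q hq hqQ p => not_approx_of_mem_shell h ha hQ hy.1 hy.2 hz hzN hzQ hzy hx hq hqQ p⟩
  · intro y t ht
    rw [Measure.map_apply hf MeasurableSet.of_discrete, ProbabilityTheory.cond_apply hGm]
    set δ : Fin 2 → ℝ := fun i => t + 3 * (Q : ℝ) ^ (-(1 + v i - η)) with hδ
    have hδ0 : ∀ i, 0 ≤ δ i := fun i => by positivity
    have hsub : G ∩ f ⁻¹' {z | (shell τ (1 / 2) (3 / 4) z ∩ Metric.ball y t).Nonempty} ⊆
        shell τ (9 / 16) (11 / 16) a ∩ Icc (y - δ) (y + δ) := by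
      rintro u ⟨hu, x, hx, hxy⟩
      obtain ⟨⟨hz, hzN, hzQ⟩, hzy⟩ := hfA u (hGA hu)
      have key : ∀ i, |u i - y i| ≤ δ i := fun i => by
        have h1 := abs_sub_le_of_mem_shell h hQ1 hzN (hzy i) hx
        have h2 : (Q : ℝ) ^ (1 - η) * |x i - u i| ≤ 3 * (Q : ℝ) ^ (-v i) := by
          refine le_trans ?_ h1
          gcongr
        have h3 : |x i - u i| ≤ 3 * (Q : ℝ) ^ (-(1 + v i - η)) := by
          have h4 : (Q : ℝ) ^ (-v i) = (Q : ℝ) ^ (1 - η) * (Q : ℝ) ^ (-(1 + v i - η)) := by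
            rw [← Real.rpow_add hQ0]
            congr 1
            ring
          rw [h4] at h2
          have h5 : (0 : ℝ) < (Q : ℝ) ^ (1 - η) := by linarith
          exact le_of_mul_le_mul_left (by linarith) h5
        have h4 : |x i - y i| ≤ t := by
          have := (dist_le_pi_dist x y i).trans (Metric.mem_ball.1 hxy).le
          rwa [Real.dist_eq] at this
        have h5 : u i - y i = (x i - y i) - (x i - u i) := by ring
        rw [h5]
        exact (abs_sub _ _).trans (add_le_add h4 h3)
      refine ⟨hu.1, fun i => ?_, fun i => ?_⟩
      · have := (abs_le.1 (key i)).1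
        simp only [Pi.sub_apply]
        linarith
      · have := (abs_le.1 (key i)).2
        simp only [Pi.add_apply]
        linarith
    have hvol := (measure_mono hsub).trans
      (volume_shell_inter_Icc_le (τ := τ) (by norm_num : (9 / 16 : ℝ) < 11 / 16) ha.1 y δ hδ0)
    have hP : (0 : ℝ) < 1 / 128 * ∏ i, (a.1 : ℝ) ^ (-(1 + τ i)) := by positivity
    calc _ ≤ (ENNReal.ofReal (1 / 128 * ∏ i, (a.1 : ℝ) ^ (-(1 + τ i))))⁻¹ * _ :=
          mul_le_mul' (ENNReal.inv_le_inv.2 hGvol) hvol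
      _ = _ := by
          rw [← ENNReal.ofReal_inv_of_pos hP, ← ENNReal.ofReal_mul (by positivity)]
          congr 1
          rw [inv_mul_eq_iff_eq_mul₀ hP.ne']
          simp only [Fin.prod_univ_two, hδ]
          rw [show (2 / (11 / 16 - 9 / 16) : ℝ) = 16 by norm_num]
          ring

theorem tendsto_natCast_rpow_neg {c : ℝ} (hc : 0 < c) :
    Filter.Tendsto (fun Q : ℕ => (Q : ℝ) ^ (-c)) Filter.atTop (nhds 0) :=
  (tendsto_rpow_neg_atTop hc).comp tendsto_natCast_atTop_atTop

theorem tendsto_natCast_rpow {c : ℝ} (hc : 0 < c) :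
    Filter.Tendsto (fun Q : ℕ => (Q : ℝ) ^ c) Filter.atTop Filter.atTop :=
  (tendsto_rpow_atTop hc).comp tendsto_natCast_atTop_atTop

theorem eventually_mul_rpow_neg_le {c b C : ℝ} (hc : 0 < c) (hb : 0 < b) :
    ∀ᶠ Q : ℕ in Filter.atTop, C * (Q : ℝ) ^ (-c) < b := by
  have h := (tendsto_natCast_rpow_neg hc).const_mul C
  rw [mul_zero] at h
  exact h.eventually_lt_const hb

theorem eventually_isLargeScale (h : IsAdmissible τ v w η) (M : ℕ) :
    ∀ᶠ Q : ℕ in Filter.atTop, ∀ q, 0 < q → q ≤ M → IsLargeScale τ v w η q Q := by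
  have h1 : ∀ i, ∀ᶠ Q : ℕ in Filter.atTop,
      48 * (Q : ℝ) ^ (-(v i * η / 2)) < ((M + 1 : ℕ) : ℝ) ^ (-(1 + τ i)) := fun i =>
    eventually_mul_rpow_neg_le (by have := mul_pos (h.v_pos i) h.eta_pos; linarith) (by positivity)
  have h2 : ∀ᶠ Q : ℕ in Filter.atTop, (M : ℝ) ≤ (Q : ℝ) ^ (1 - η) :=
    (tendsto_natCast_rpow (by linarith [h.eta_lt])).eventually_ge_atTop _
  have h3 : ∀ i, ∀ᶠ Q : ℕ in Filter.atTop, 2 < (Q : ℝ) ^ (τ i - (w i + η * (1 + τ i))) := fun i =>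
    (tendsto_natCast_rpow (by linarith [h.w_lt i])).eventually_gt_atTop _
  filter_upwards [Filter.eventually_all.2 h1, h2, Filter.eventually_all.2 h3,
    Filter.eventually_gt_atTop 0] with Q h1 h2 h3 hQ q hq hqM
  have hQ0 : (0 : ℝ) < Q := by exact_mod_cast hQ
  have hq0 : (0 : ℝ) < q := by exact_mod_cast hq
  refine ⟨fun i => (h1 i).le.trans ?_, le_trans (by exact_mod_cast hqM) h2, fun i => ?_⟩
  · exact Real.rpow_le_rpow_of_nonpos hq0 (by exact_mod_cast hqM.trans M.le_succ)
      (by linarith [h.tau_pos i])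
  · have h4 : (Q : ℝ) ^ (-w i) = (Q : ℝ) ^ (τ i - (w i + η * (1 + τ i))) *
        ((Q : ℝ) ^ η * ((Q : ℝ) ^ (1 - η)) ^ (-τ i)) := by
      rw [← Real.rpow_mul hQ0.le, ← Real.rpow_add hQ0, ← Real.rpow_add hQ0]
      congr 1
      ring
    rw [h4, mul_assoc]
    have : (0 : ℝ) < (Q : ℝ) ^ η * ((Q : ℝ) ^ (1 - η)) ^ (-τ i) := by positivity
    have := h3 i
    gcongr

theorem volume_unit_approx_le {n : ℕ} (hn : 0 < n) {θ : Fin 2 → ℝ} (hθ : ∀ i, 0 < θ i)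
    (hθ3 : ∀ i, θ i ≤ 3) :
    volume {y : Fin 2 → ℝ | (∀ i, y i ∈ Icc (0 : ℝ) 1) ∧
      ∃ b : Fin 2 → ℤ, ∀ i, |(n : ℝ) * y i - b i| < θ i} ≤
      ENNReal.ofReal (256 * ∏ i, θ i) := by
  have hn1 : (1 : ℝ) ≤ n := by exact_mod_cast hn
  obtain ⟨T, hT, hcard⟩ : ∃ T : Finset (Fin 2 → ℤ),
      (∀ b : Fin 2 → ℤ, (∀ i, -3 ≤ b i ∧ b i ≤ (n : ℤ) + 3) → b ∈ T) ∧
        (T.card : ℝ) ≤ 64 * n ^ 2 := by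
    refine ⟨Fintype.piFinset fun _ => Finset.Icc (-3) ((n : ℤ) + 3), fun b hb => ?_, ?_⟩
    · rw [Fintype.mem_piFinset]
      exact fun i => Finset.mem_Icc.2 (hb i)
    · have h7 : ((n : ℤ) + 3 + 1 - (-3)).toNat = n + 7 := by omega
      rw [Fintype.card_piFinset]
      simp only [Int.card_Icc, Finset.prod_const, Finset.card_univ, Fintype.card_fin, h7]
      push_cast
      nlinarith
  have hsub : {y : Fin 2 → ℝ | (∀ i, y i ∈ Icc (0 : ℝ) 1) ∧
      ∃ b : Fin 2 → ℤ, ∀ i, |(n : ℝ) * y i - b i| < θ i} ⊆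
      ⋃ b ∈ T, {y : Fin 2 → ℝ | ∀ i, |(n : ℝ) * y i - b i| < θ i} := by
    rintro y ⟨hy, b, hb⟩
    simp only [Set.mem_iUnion]
    refine ⟨b, hT b fun i => ?_, hb⟩
    have h1 := abs_lt.1 (hb i)
    have h2 := hy i
    have h3 := hθ3 i
    constructor
    · have : (-3 : ℝ) ≤ b i := by nlinarith [h2.1]
      exact_mod_cast this
    · have : (b i : ℝ) ≤ n + 3 := by nlinarith [h2.2]
      exact_mod_cast this
  have heach : ∀ b ∈ T, volume {y : Fin 2 → ℝ | ∀ i, |(n : ℝ) * y i - b i| < θ i} ≤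
      ∏ i, ENNReal.ofReal (2 * θ i / n) :=
    fun b _ => volume_forall_abs_lt_le (s := (n, b)) hn θ
  refine (measure_mono hsub).trans ((measure_biUnion_finset_le _ _).trans
    ((Finset.sum_le_card_nsmul _ _ _ heach).trans ?_))
  rw [← ENNReal.ofReal_prod_of_nonneg (fun i _ => by have := hθ i; positivity),
    nsmul_eq_mul, ← ENNReal.ofReal_natCast, ← ENNReal.ofReal_mul (by positivity)]
  refine ENNReal.ofReal_le_ofReal ?_
  have h0 := hθ 0
  have h1 := hθ 1
  calc (T.card : ℝ) * ∏ i, 2 * θ i / n ≤ 64 * n ^ 2 * ∏ i, 2 * θ i / n :=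
        mul_le_mul_of_nonneg_right hcard
          (Finset.prod_nonneg fun i _ => by have := hθ i; positivity)
    _ = _ := by
        simp only [Fin.prod_univ_two]
        field_simp
        norm_num

theorem exists_regular_shell_subset (h : IsAdmissible τ v w η) (q₀ : ℕ) {x : Fin 2 → ℝ} {r : ℝ}
    (hr : 0 < r) (hB : Metric.closedBall x r ⊆ {y : Fin 2 → ℝ | ∀ i, y i ∈ Icc (0 : ℝ) 1}) :
    ∃ a : ℕ × (Fin 2 → ℤ), IsRegularPoint w a ∧ q₀ ≤ a.1 ∧
      shell τ (1 / 2) (3 / 4) a ⊆ Metric.closedBall x r := by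
  have e1 : ∀ᶠ Q : ℕ in Filter.atTop, 2304 * (Q : ℝ) ^ (-η) < r ^ 2 :=
    eventually_mul_rpow_neg_le h.eta_pos (by positivity)
  have e2 : ∀ i, ∀ᶠ Q : ℕ in Filter.atTop, 3 * (Q : ℝ) ^ (-v i) < r / 2 := fun i =>
    eventually_mul_rpow_neg_le (h.v_pos i) (by positivity)
  have e3 : ∀ᶠ Q : ℕ in Filter.atTop, (q₀ : ℝ) ≤ (Q : ℝ) ^ (1 - η) :=
    (tendsto_natCast_rpow (by linarith [h.eta_lt])).eventually_ge_atTop _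
  obtain ⟨Q, e1, e2, e3, hQ⟩ := (e1.and ((Filter.eventually_all.2 e2).and (e3.and
    (Filter.eventually_gt_atTop 0)))).exists
  have hQ1 : (1 : ℝ) ≤ Q := by exact_mod_cast hQ
  have hQ0 : (0 : ℝ) < Q := by linarith
  have hN1 : (1 : ℝ) ≤ (Q : ℝ) ^ (1 - η) := Real.one_le_rpow hQ1 (by linarith [h.eta_lt])
  obtain ⟨y, hyx, hy⟩ : ∃ y ∈ Metric.closedBall x (r / 2), ∀ n : ℕ, 0 < n →
      (n : ℝ) ≤ (Q : ℝ) ^ (1 - η) → ∀ b : Fin 2 → ℤ,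
        ¬ ∀ i, |(n : ℝ) * y i - b i| ≤ 2 * (Q : ℝ) ^ (-v i) := by
    by_contra! hcon
    set T := (Finset.range (⌊(Q : ℝ) ^ (1 - η)⌋₊ + 1)).filter fun n => 0 < n with hT
    have hsub : Metric.closedBall x (r / 2) ⊆ ⋃ n ∈ T, {y : Fin 2 → ℝ |
        (∀ i, y i ∈ Icc (0 : ℝ) 1) ∧
          ∃ b : Fin 2 → ℤ, ∀ i, |(n : ℝ) * y i - b i| < 3 * (Q : ℝ) ^ (-v i)} := by
      intro y hy
      obtain ⟨n, hn, hnN, b, hb⟩ := hcon y hy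
      simp only [Set.mem_iUnion]
      refine ⟨n, ?_, hB (Metric.closedBall_subset_closedBall (by linarith) hy), b, fun i => ?_⟩
      · rw [hT, Finset.mem_filter, Finset.mem_range, Nat.lt_succ_iff]
        exact ⟨Nat.le_floor hnN, hn⟩
      · have : (0 : ℝ) < (Q : ℝ) ^ (-v i) := by positivity
        linarith [hb i]
    have hvol := (measure_mono hsub).trans ((measure_biUnion_finset_le (μ := volume) _ _).trans
      (Finset.sum_le_card_nsmul _ _ _ fun n hn => volume_unit_approx_le
        (Finset.mem_filter.1 hn).2 (θ := fun i => 3 * (Q : ℝ) ^ (-v i)) (fun i => by positivity)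
        fun i => by
          have := Real.rpow_le_one_of_one_le_of_nonpos hQ1 (by linarith [h.v_pos i] : -v i ≤ 0)
          linarith))
    rw [Real.volume_pi_closedBall _ (by positivity), nsmul_eq_mul, ← ENNReal.ofReal_natCast,
      ← ENNReal.ofReal_mul (by positivity), ENNReal.ofReal_le_ofReal_iff (by positivity)] at hvol
    have hcard : (T.card : ℝ) ≤ (Q : ℝ) ^ (1 - η) := by
      have h1 : T.card ≤ ⌊(Q : ℝ) ^ (1 - η)⌋₊ := by
        have : T ⊆ Finset.Icc 1 ⌊(Q : ℝ) ^ (1 - η)⌋₊ := fun n hn => by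
          rw [hT, Finset.mem_filter, Finset.mem_range, Nat.lt_succ_iff] at hn
          exact Finset.mem_Icc.2 ⟨hn.2, hn.1⟩
        simpa using Finset.card_le_card this
      exact le_trans (by exact_mod_cast h1) (Nat.floor_le (by positivity))
    have hprod : ∏ i, 3 * (Q : ℝ) ^ (-v i) = 9 * (Q : ℝ) ^ (-1 : ℝ) := by
      have hv := h.v_sum
      rw [Fin.sum_univ_two] at hv
      have h2 : (Q : ℝ) ^ (-1 : ℝ) = (Q : ℝ) ^ (-v 0) * (Q : ℝ) ^ (-v 1) := by
        rw [← Real.rpow_add hQ0]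
        congr 1
        linarith
      rw [Fin.prod_univ_two, h2]
      ring
    rw [hprod] at hvol
    have h3 : (T.card : ℝ) * (256 * (9 * (Q : ℝ) ^ (-1 : ℝ))) ≤ 2304 * (Q : ℝ) ^ (-η) := by
      calc _ ≤ (Q : ℝ) ^ (1 - η) * (256 * (9 * (Q : ℝ) ^ (-1 : ℝ))) := by gcongr
        _ = 2304 * ((Q : ℝ) ^ (1 - η) * (Q : ℝ) ^ (-1 : ℝ)) := by ring
        _ = _ := by
          rw [← Real.rpow_add hQ0]
          congr 2
          ring
    simp only [Fintype.card_fin] at hvol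
    have h4 : (2 * (r / 2)) ^ 2 = r ^ 2 := by ring
    linarith
  obtain ⟨z, hz, hzN, -, hzy⟩ := exists_regular_of_forall_not_approx (y := y) h.v_pos h.v_sum
    h.w_pos hQ hN1 (fun i => by
      rw [← Real.rpow_mul hQ0.le]
      exact Real.rpow_le_rpow_of_exponent_le hQ1 (by linarith [h.v_le i])) hy
  refine ⟨z, hz, by exact_mod_cast e3.trans hzN.le, fun u hu => ?_⟩
  have hz1 : (1 : ℝ) ≤ z.1 := hN1.trans hzN.le
  have huy : dist u y ≤ r / 2 := by
    rw [dist_pi_le_iff (by positivity)]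
    intro i
    rw [Real.dist_eq]
    have h1 := abs_sub_le_of_mem_shell h hQ1 hzN.le (hzy i) hu
    nlinarith [abs_nonneg (u i - y i), e2 i]
  rw [Metric.mem_closedBall] at hyx ⊢
  linarith [dist_triangle u y x]

theorem finite_setOf_shell_subset {x : Fin 2 → ℝ} {r : ℝ}
    (hB : Metric.closedBall x r ⊆ {y : Fin 2 → ℝ | ∀ i, y i ∈ Icc (0 : ℝ) 1})
    (hτ : ∀ i, 0 < τ i) (M : ℕ) :
    {z : ℕ × (Fin 2 → ℤ) | 0 < z.1 ∧ z.1 ≤ M ∧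
      shell τ (1 / 2) (3 / 4) z ⊆ Metric.closedBall x r}.Finite := by
  refine ((Finset.range (M + 1) ×ˢ Fintype.piFinset fun _ : Fin 2 =>
    Finset.Icc (-(M : ℤ)) M).finite_toSet).subset ?_
  rintro z ⟨hz, hzM, hsub⟩
  have hq : (0 : ℝ) < z.1 := by exact_mod_cast hz
  have hq1 : (1 : ℝ) ≤ z.1 := by exact_mod_cast hz
  rw [Finset.mem_coe, Finset.mem_product, Finset.mem_range, Nat.lt_succ_iff, Fintype.mem_piFinset]
  refine ⟨hzM, fun i => ?_⟩
  have hmem : (fun i => ratPoint z i + 1 / 2 * (z.1 : ℝ) ^ (-(1 + τ i))) ∈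
      shell τ (1 / 2) (3 / 4) z := by
    refine ⟨le_rfl, fun i => ?_⟩
    have : (0 : ℝ) < (z.1 : ℝ) ^ (-(1 + τ i)) := by positivity
    simp only
    linarith
  have h1 := hB (hsub hmem) i
  simp only [ratPoint] at h1
  have h2 : (0 : ℝ) < (z.1 : ℝ) ^ (-(1 + τ i)) := by positivity
  have h3 : (z.1 : ℝ) ^ (-(1 + τ i)) ≤ 1 :=
    Real.rpow_le_one_of_one_le_of_nonpos hq1 (by linarith [hτ i])
  have h4 : (z.2 i : ℝ) / z.1 ≤ 1 := by linarith [h1.2]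
  have h5 : -1 ≤ (z.2 i : ℝ) / z.1 := by linarith [h1.1]
  rw [div_le_iff₀ hq] at h4
  rw [le_div_iff₀ hq] at h5
  have h6 : z.2 i ≤ z.1 := by
    have : (z.2 i : ℝ) ≤ z.1 := by linarith
    exact_mod_cast this
  have h7 : -(z.1 : ℤ) ≤ z.2 i := by
    have : -(z.1 : ℝ) ≤ z.2 i := by linarith
    exact_mod_cast this
  rw [Finset.mem_Icc]
  have : (z.1 : ℤ) ≤ M := by exact_mod_cast hzM
  constructor <;> linarith

theorem mem_badSet_of_forall_exists_shell {Qs : ℕ → ℕ}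
    (hQs : ∀ n, (Qs n : ℝ) + 1 ≤ (Qs (n + 1) : ℝ) ^ (1 - η)) (hmono : StrictMono Qs)
    {u : Fin 2 → ℝ} (hu : ∀ i, u i ∈ Icc (0 : ℝ) 1)
    (hz : ∀ n, ∃ z : ℕ × (Fin 2 → ℤ), 0 < z.1 ∧ (Qs n : ℝ) ^ (1 - η) ≤ z.1 ∧
      u ∈ shell τ (1 / 2) (3 / 4) z)
    (hu4 : ∀ n q : ℕ, Qs n ≤ q → q < Qs (n + 1) → ∀ p : Fin 2 → ℤ,
      ¬ ∀ i, |(q : ℝ) * u i - p i| < 1 / 4 * (q : ℝ) ^ (-τ i)) :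
    u ∈ badSet 2 (psiTau 2 τ) := by
  refine ⟨⟨hu, Set.infinite_of_forall_exists_gt fun n => ?_⟩, fun hmem => ?_⟩
  · obtain ⟨z, hz0, hzQ, huz⟩ := hz (n + 1)
    have hq : (0 : ℝ) < z.1 := by exact_mod_cast hz0
    refine ⟨z.1, ⟨hz0, z.2, fun i => ?_⟩, ?_⟩
    · have h1 := huz.1 i
      have h2 := huz.2 i
      simp only at h1 h2
      have h3 : (0 : ℝ) < (z.1 : ℝ) ^ (-(1 + τ i)) := by positivity
      have h4 : (z.1 : ℝ) * u i - z.2 i = z.1 * (u i - ratPoint z i) := by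
        simp only [ratPoint]
        field_simp
      have h5 : psiTau 2 τ z.1 i = z.1 * (z.1 : ℝ) ^ (-(1 + τ i)) := by
        simp only [psiTau]
        rw [neg_add, Real.rpow_add hq, Real.rpow_neg_one]
        field_simp
      rw [h4, h5, abs_of_nonneg (mul_nonneg hq.le (by linarith))]
      exact mul_lt_mul_of_pos_left (by linarith) hq
    · have h1 : (n : ℝ) ≤ Qs n := by exact_mod_cast hmono.id_le n
      have h2 : (n : ℝ) < z.1 := by linarith [hQs n]
      exact_mod_cast h2
  · have h1 := (Set.mem_iInter₂.1 hmem (1 / 4) ⟨by norm_num, by norm_num⟩).2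
    refine h1 ((Set.finite_Iio (Qs 0)).subset ?_)
    rintro q ⟨hq0, p, hp⟩
    by_contra hq
    rw [Set.mem_Iio, not_lt] at hq
    have hex : ∃ n, q < Qs n := ⟨q + 1, (Nat.lt_succ_self q).trans_le (hmono.id_le _)⟩
    have hpos : Nat.find hex ≠ 0 := fun h0 => by
      have := Nat.find_spec hex
      rw [h0] at this
      omega
    obtain ⟨m, hm⟩ := Nat.exists_eq_succ_of_ne_zero hpos
    have h2 := Nat.find_spec hex
    rw [hm] at h2
    have h3 := Nat.find_min hex (m := m) (by omega)
    exact hu4 m q (not_lt.1 h3) h2 p hp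

/-- A measure on the badly approximable points of a ball, together with bounds for the mass of
balls in terms of a rapidly increasing sequence of scales. -/
theorem exists_measure_on_badSet (h : IsAdmissible τ v w η) {P : ℕ → ℕ → Prop}
    (hP : ∀ M, ∀ᶠ Q in Filter.atTop, P M Q) {x : Fin 2 → ℝ} {r : ℝ} (hr : 0 < r)
    (hB : Metric.closedBall x r ⊆ {y : Fin 2 → ℝ | ∀ i, y i ∈ Icc (0 : ℝ) 1}) :
    ∃ (μ : Measure (Fin 2 → ℝ)) (Qs : ℕ → ℕ), IsProbabilityMeasure μ ∧
      measSupport μ ⊆ Metric.closedBall x r ∩ badSet 2 (psiTau 2 τ) ∧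
      0 < Qs 0 ∧ StrictMono Qs ∧ (∀ n, P (Qs n) (Qs (n + 1))) ∧
      ∀ (n : ℕ) (y : Fin 2 → ℝ) (t : ℝ), 0 ≤ t → μ (Metric.ball y t) ≤
        ENNReal.ofReal (2 * ∏ i, min 1 (16 * (Qs (n + 1) : ℝ) ^ (1 + τ i) *
            (t + 3 * (Qs (n + 2) : ℝ) ^ (-(1 + v i - η))))) *
        ENNReal.ofReal (2 * ∏ i, min 1 (16 * (Qs n : ℝ) ^ (1 + τ i) *
            (t + 3 * (Qs (n + 1) : ℝ) ^ (-(1 + v i - η))))) := by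
  classical
  obtain ⟨q₀, hq₀, hq₀1⟩ : ∃ q₀ : ℕ, (∀ q ≥ q₀, 4096 * (∑' k : ℕ, (k : ℝ) ^ (-(1 + η / 2))) *
      (q : ℝ) ^ (-(2 * η)) ≤ 1 / 128) ∧ 0 < q₀ := by
    have h1 := eventually_mul_rpow_neg_le (C := 4096 * (∑' k : ℕ, (k : ℝ) ^ (-(1 + η / 2))))
      (b := 1 / 128) (by linarith [h.eta_pos] : 0 < 2 * η) (by norm_num)
    obtain ⟨q₀, hq₀⟩ := Filter.eventually_atTop.1 h1
    exact ⟨q₀ + 1, fun q hq => (hq₀ q (by omega)).le, q₀.succ_pos⟩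
  obtain ⟨a₀, ha₀, ha₀q, ha₀B⟩ := exists_regular_shell_subset h q₀ hr hB
  have hex : ∀ M : ℕ, ∃ Q : ℕ, P M Q ∧ (∀ q, 0 < q → q ≤ M → IsLargeScale τ v w η q Q) ∧
      (M : ℝ) + 1 ≤ (Q : ℝ) ^ (1 - η) ∧ 0 < Q := fun M =>
    ((hP M).and ((eventually_isLargeScale h M).and (((tendsto_natCast_rpow
      (by linarith [h.eta_lt])).eventually_ge_atTop _).and
        (Filter.eventually_gt_atTop 0)))).exists
  choose F hFP hFL hFM hF0 using hex
  let Qs : ℕ → ℕ := fun n => F^[n] a₀.1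
  have hQ0 : Qs 0 = a₀.1 := rfl
  have hQsucc : ∀ n, Qs (n + 1) = F (Qs n) := fun n => Function.iterate_succ_apply' F n a₀.1
  have hgrow : ∀ n, (Qs n : ℝ) + 1 ≤ (Qs (n + 1) : ℝ) ^ (1 - η) := fun n => by
    rw [hQsucc]
    exact hFM _
  have hpos : ∀ n, 0 < Qs n := fun n => by
    cases n with
    | zero => exact ha₀.1
    | succ n => rw [hQsucc]; exact hF0 _
  have hrpow : ∀ n, (Qs n : ℝ) ^ (1 - η) ≤ Qs n := fun n => by
    have h1 : (1 : ℝ) ≤ Qs n := by exact_mod_cast hpos n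
    exact Real.rpow_le_self_of_one_le h1 (by linarith [h.eta_pos])
  have hmono : StrictMono Qs := strictMono_nat_of_lt_succ fun n => by
    have : (Qs n : ℝ) < Qs (n + 1) := by linarith [hgrow n, hrpow (n + 1)]
    exact_mod_cast this
  let R : ℕ × (Fin 2 → ℤ) → Set (Fin 2 → ℝ) := shell τ (1 / 2) (3 / 4)
  let L : ℕ → Set (ℕ × (Fin 2 → ℤ)) := fun n => {z | IsRegularPoint w z ∧ q₀ ≤ z.1 ∧
    z.1 ≤ Qs n ∧ (Qs n : ℝ) ^ (1 - η) ≤ z.1 ∧ R z ⊆ Metric.closedBall x r ∧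
    ∀ m, n = m + 1 → ∀ u ∈ R z, ∀ q : ℕ, Qs m ≤ q → q < Qs (m + 1) → ∀ p : Fin 2 → ℤ,
      ¬ ∀ i, |(q : ℝ) * u i - p i| < 1 / 4 * (q : ℝ) ^ (-τ i)}
  have hstep : ∀ n a, ∃ κ : Measure (ℕ × (Fin 2 → ℤ)), IsProbabilityMeasure κ ∧ (a ∈ L n →
      (∀ᵐ z ∂κ, z ∈ L (n + 1) ∧ R z ⊆ R a) ∧
      ∀ (y : Fin 2 → ℝ) (t : ℝ), 0 ≤ t → κ {z | (R z ∩ Metric.ball y t).Nonempty} ≤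
        ENNReal.ofReal (2 * ∏ i, min 1 (16 * (Qs n : ℝ) ^ (1 + τ i) *
            (t + 3 * (Qs (n + 1) : ℝ) ^ (-(1 + v i - η)))))) := by
    intro n a
    by_cases ha : a ∈ L n
    · obtain ⟨har, haq, haQ, -, haB, -⟩ := ha
      have hlarge : IsLargeScale τ v w η a.1 (Qs (n + 1)) := by
        rw [hQsucc]
        exact hFL _ _ har.1 haQ
      obtain ⟨κ, hκ, hκL, hκb⟩ := exists_descendant_measure h har hlarge (hq₀ _ haq)
      refine ⟨κ, hκ, fun _ => ⟨?_, fun y t ht => (hκb y t ht).trans ?_⟩⟩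
      · filter_upwards [hκL] with z hz
        obtain ⟨hzr, hzN, hzQ, hza, hzavoid⟩ := hz
        refine ⟨⟨hzr, ?_, hzQ, hzN, hza.trans haB, ?_⟩, hza⟩
        · have h1 : (a.1 : ℝ) ≤ z.1 := hlarge.le_rpow.trans hzN
          exact haq.trans (by exact_mod_cast h1)
        · intro m hm u hu q hq hqQ
          obtain rfl : n = m := by omega
          exact hzavoid u hu q (haQ.trans hq) hqQ
      · refine ENNReal.ofReal_le_ofReal ?_
        have haQ' : (a.1 : ℝ) ≤ Qs n := by exact_mod_cast haQ
        gcongr with i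
        linarith [h.tau_pos i]
    · exact ⟨Measure.dirac a, inferInstance, fun ha' => absurd ha' ha⟩
  choose κ hκ hκL using hstep
  have hR : ∀ z, (R z).Nonempty := fun z => by
    refine Set.nonempty_Icc.2 fun i => ?_
    have : (0 : ℝ) ≤ (z.1 : ℝ) ^ (-(1 + τ i)) := by positivity
    simp only
    linarith
  have ha₀L : a₀ ∈ L 0 :=
    ⟨ha₀, ha₀q, hQ0.ge, by simpa [hQ0] using hrpow 0, ha₀B, fun m hm => by omega⟩
  obtain ⟨μ, hμ, hμsupp, hμball⟩ := exists_measure_of_descent (κ := κ) (L := L) (R := R)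
    hκ (fun n a ha => (hκL n a ha).1) hR ha₀L isCompact_Icc
  refine ⟨μ, Qs, hμ, ?_, hpos 0, hmono, fun n => by rw [hQsucc]; exact hFP _, ?_⟩
  · intro u hu
    have hmem : ∀ n, ∃ z ∈ L n, u ∈ R z := by
      intro n
      have hfin : (L n).Finite := (finite_setOf_shell_subset hB h.tau_pos (Qs n)).subset
        fun z hz => ⟨hz.1.1, hz.2.2.1, hz.2.2.2.2.1⟩
      have hclosed : IsClosed (⋃ z ∈ L n, R z) := hfin.isClosed_biUnion fun z _ => isClosed_Icc
      by_contra hcon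
      have hnot : u ∈ (⋃ z ∈ L n, R z)ᶜ := by
        simp only [Set.mem_compl_iff, Set.mem_iUnion]
        rintro ⟨z, hz, huz⟩
        exact hcon ⟨z, hz, huz⟩
      refine (hu _ hclosed.isOpen_compl hnot).ne' (hμsupp n _ hclosed.isOpen_compl fun z hz => ?_)
      exact Set.disjoint_compl_right_iff_subset.2 (Set.subset_biUnion_of_mem hz)
    obtain ⟨z₀, hz₀, huz₀⟩ := hmem 0
    have huB : u ∈ Metric.closedBall x r := hz₀.2.2.2.2.1 huz₀
    refine ⟨huB, mem_badSet_of_forall_exists_shell hgrow hmono (hB huB) (fun n => ?_) ?_⟩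
    · obtain ⟨z, hz, huz⟩ := hmem n
      exact ⟨z, hz.1.1, hz.2.2.2.1, huz⟩
    · intro n q hq hqQ p
      obtain ⟨z, hz, huz⟩ := hmem (n + 1)
      exact hz.2.2.2.2.2 n rfl u huz q hq hqQ p
  · intro n y t ht
    exact hμball n _ _ _ Metric.isOpen_ball (fun a ha => (hκL n a ha).2 y t ht)
      fun a ha => (hκL (n + 1) a ha).2 y t ht

/-- The decay exponent, to base `Q`, of the mass carried along one axis by an interval of length
`Q ^ (-t)`, when the boxes have side `Q ^ (-(1 + τ))` and are spaced `Q ^ (-(1 + v))` apart. -/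
def scaleExponent (τ v t : ℝ) : ℝ := max 0 (t - (1 + τ)) + min t (1 + v)

theorem exists_weight {τ1 τ2 S ε : ℝ} (hτ : τ2 ≤ τ1) (hτ2 : 0 < τ2) (hsum : 1 < τ1 + τ2)
    (hε : 0 < ε) (hS1 : S * (1 + τ1) ≤ 3 + τ1 - τ2) (hS2 : S * (1 + τ2) ≤ 3) :
    ∃ u : ℝ, 0 < u ∧ u ≤ 1 / 2 ∧ u < τ2 ∧ 1 - u < τ1 ∧ ∀ t, 1 ≤ t →
      (S - ε) * t ≤ scaleExponent τ1 (1 - u) t + scaleExponent τ2 u t := by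
  obtain ⟨δ, hδ, hδε⟩ : ∃ δ, 0 < δ ∧ δ < min ε (min τ2 (τ1 + τ2 - 1)) :=
    exists_between (lt_min hε (lt_min hτ2 (by linarith)))
  simp only [lt_min_iff] at hδε
  obtain ⟨hδε, hδτ, hδs⟩ := hδε
  unfold scaleExponent
  rcases le_total (1 / 2) (τ2 - δ) with hc | hc
  · refine ⟨1 / 2, by norm_num, le_rfl, by linarith, by linarith, fun t ht => ?_⟩
    have hS : S ≤ 2 := by
      by_contra! h
      nlinarith
    have hεt : 0 ≤ ε * t := by positivity
    suffices S * t ≤ max 0 (t - (1 + τ1)) + min t (1 + (1 - 1 / 2)) +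
      (max 0 (t - (1 + τ2)) + min t (1 + 1 / 2)) by linarith
    have m1 := le_max_left 0 (t - (1 + τ1))
    have m2 := le_max_left 0 (t - (1 + τ2))
    have m3 := le_max_right 0 (t - (1 + τ1))
    have m4 := le_max_right 0 (t - (1 + τ2))
    norm_num
    rcases le_total t (3 / 2) with h1 | h1
    · rw [min_eq_left h1]
      nlinarith
    rw [min_eq_right h1]
    rcases le_total t (1 + τ2) with h2 | h2
    · rcases le_total 0 S with h0 | h0 <;> nlinarith
    rcases le_total t (1 + τ1) with h3 | h3
    · rcases le_total S 1 with h0 | h0 <;> nlinarith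
    · nlinarith
  · refine ⟨τ2 - δ, by linarith, hc, by linarith, by linarith, fun t ht => ?_⟩
    have hS : S ≤ 2 := by
      by_contra! h
      nlinarith
    have h2 : t - δ ≤ max 0 (t - (1 + τ2)) + min t (1 + (τ2 - δ)) := by
      have m2 := le_max_left 0 (t - (1 + τ2))
      have m4 := le_max_right 0 (t - (1 + τ2))
      rcases min_cases t (1 + (τ2 - δ)) with h | h <;> linarith
    have h1 : (S - 1) * t ≤ max 0 (t - (1 + τ1)) + min t (1 + (1 - (τ2 - δ))) := by
      have m1 := le_max_left 0 (t - (1 + τ1))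
      have m3 := le_max_right 0 (t - (1 + τ1))
      rcases min_cases t (1 + (1 - (τ2 - δ))) with h | h
      · nlinarith
      rcases le_total t (1 + τ1) with h3 | h3
      · rcases le_total 1 S with h0 | h0 <;> nlinarith
      · nlinarith
    nlinarith

theorem exists_isAdmissible {τ1 τ2 S ε : ℝ} (hτ : τ2 ≤ τ1) (hτ2 : 0 < τ2) (hsum : 1 < τ1 + τ2)
    (hε : 0 < ε) (hS1 : S * (1 + τ1) ≤ 3 + τ1 - τ2) (hS2 : S * (1 + τ2) ≤ 3) :
    ∃ (v w : Fin 2 → ℝ) (η : ℝ), IsAdmissible ![τ1, τ2] v w η ∧ 3 * η ≤ ε ∧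
      (∀ i, v 1 ≤ v i) ∧ η ≤ v 1 ∧
      ∀ t, 1 ≤ t → (S - ε) * t ≤ ∑ i, scaleExponent (![τ1, τ2] i) (v i) t := by
  obtain ⟨u, hu0, hu, hu2, hu1, hut⟩ := exists_weight hτ hτ2 hsum hε hS1 hS2
  have key : ∀ {d : ℝ}, 0 < d → ∀ K : ℝ, ∀ᶠ η in nhdsWithin (0 : ℝ) (Ioi 0), η * K < d := by
    intro d hd K
    have : Filter.Tendsto (fun η : ℝ => η * K) (nhds 0) (nhds (0 * K)) :=
      (continuous_mul_const K).tendsto 0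
    rw [zero_mul] at this
    exact (this.eventually_lt_const hd).filter_mono nhdsWithin_le_nhds
  obtain ⟨η, k1, k2, k3, k4, k5, k6, k7, k8, k9, hη⟩ :=
    ((key (sub_pos.2 hu1) (1 - u + τ1)).and <| (key (sub_pos.2 hu2) (u + τ2)).and <|
      (key (sub_pos.2 hu1) (2 * (1 + τ1))).and <| (key (sub_pos.2 hu2) (2 * (1 + τ2))).and <|
      (key (sub_pos.2 hu1) ((1 - u) / 2)).and <| (key (sub_pos.2 hu2) (u / 2)).and <|
      (key hε 3).and <| (key hu0 1).and <| (key one_pos 1).and self_mem_nhdsWithin).exists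
  refine ⟨![1 - u, u], ![(1 - u + τ1) / 2, (u + τ2) / 2], η,
    ⟨?_, ?_, hη, ?_, ?_, ?_, ?_⟩, ?_, ?_, ?_, fun t ht => ?_⟩
  all_goals
    try simp only [Fin.forall_fin_two, Fin.sum_univ_two, Matrix.cons_val_zero, Matrix.cons_val_one]
  · constructor <;> linarith
  · ring
  · linarith
  · constructor <;> linarith
  · constructor <;> linarith
  · constructor <;> linarith
  · linarith
  · constructor <;> linarith
  · linarith
  · exact hut t ht

theorem exists_between_scales {Qs : ℕ → ℕ} (hQs : StrictMono Qs) {c s : ℝ} (hc : 0 < c)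
    (hs : 0 < s) (h1 : s < (Qs 1 : ℝ) ^ (-c)) :
    ∃ n, s < (Qs (n + 1) : ℝ) ^ (-c) ∧ (Qs (n + 2) : ℝ) ^ (-c) ≤ s := by
  by_contra! hcon
  have hall : ∀ n, s < (Qs (n + 1) : ℝ) ^ (-c) := fun n => by
    induction n with
    | zero => exact h1
    | succ n ih => exact hcon n ih
  have ht : Filter.Tendsto (fun n => (Qs (n + 1) : ℝ) ^ (-c)) Filter.atTop (nhds 0) :=
    (tendsto_natCast_rpow_neg hc).comp (hQs.tendsto_atTop.comp (Filter.tendsto_add_atTop_nat 1))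
  obtain ⟨n, hn⟩ := (ht.eventually_lt_const hs).exists
  exact lt_asymm hn (hall n)

theorem min_one_mul_add_le {Q K a b t : ℝ} (hQ : 1 ≤ Q) (hK : 1 ≤ K) :
    min 1 (K * (Q ^ (1 + a) * Q ^ (-t))) * (Q ^ (-t) + Q ^ (-(1 + b))) ≤
      2 * K * Q ^ (-scaleExponent a b t) := by
  have hQ0 : 0 < Q := by linarith
  have h1 : min 1 (K * (Q ^ (1 + a) * Q ^ (-t))) ≤ K * Q ^ (-max 0 (t - (1 + a))) := by
    rcases max_cases 0 (t - (1 + a)) with ⟨h, -⟩ | ⟨h, -⟩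
    · rw [h, neg_zero, Real.rpow_zero, mul_one]
      exact (min_le_left _ _).trans hK
    · rw [h, ← Real.rpow_add hQ0, show 1 + a + -t = -(t - (1 + a)) by ring]
      exact min_le_right _ _
  have h2 : Q ^ (-t) + Q ^ (-(1 + b)) ≤ 2 * Q ^ (-min t (1 + b)) := by
    have e1 : Q ^ (-t) ≤ Q ^ (-min t (1 + b)) :=
      Real.rpow_le_rpow_of_exponent_le hQ (neg_le_neg (min_le_left _ _))
    have e2 : Q ^ (-(1 + b)) ≤ Q ^ (-min t (1 + b)) :=
      Real.rpow_le_rpow_of_exponent_le hQ (neg_le_neg (min_le_right _ _))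
    linarith
  calc _ ≤ K * Q ^ (-max 0 (t - (1 + a))) * (2 * Q ^ (-min t (1 + b))) := by gcongr
    _ = 2 * K * (Q ^ (-max 0 (t - (1 + a))) * Q ^ (-min t (1 + b))) := by ring
    _ = _ := by
      rw [← Real.rpow_add hQ0, scaleExponent]
      congr 2
      ring

/-- The estimate on the mass of a ball, in terms of three consecutive scales `M`, `Q`, `R`. -/
theorem prod_mul_prod_le (h : IsAdmissible τ v w η) {S ε : ℝ} (hη3 : 3 * η ≤ ε)
    (hv : ∀ i, v 1 ≤ v i) (hηv : η ≤ v 1)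
    (hS : ∀ t, 1 ≤ t → (S - ε) * t ≤ ∑ i, scaleExponent (τ i) (v i) t)
    {M Q R : ℕ} (hQ : 2 ≤ Q) (hR : 2 ≤ R)
    (hMQ : ∏ i, 48 * (M : ℝ) ^ (1 + τ i) ≤ (Q : ℝ) ^ η) {s : ℝ} (hs : 0 < s)
    (hsQ : s < (Q : ℝ) ^ (-(1 + v 1 - η))) (hRs : (R : ℝ) ^ (-(1 + v 1 - η)) ≤ s) :
    (2 * ∏ i, min 1 (16 * (Q : ℝ) ^ (1 + τ i) * (2 * s + 3 * (R : ℝ) ^ (-(1 + v i - η))))) *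
      (2 * ∏ i, min 1 (16 * (M : ℝ) ^ (1 + τ i) * (2 * s + 3 * (Q : ℝ) ^ (-(1 + v i - η))))) ≤
      102400 * s ^ (S - 2 * ε) := by
  have hQ1 : (1 : ℝ) < Q := by exact_mod_cast hQ
  have hQ0 : (0 : ℝ) < Q := by linarith
  have hR1 : (1 : ℝ) ≤ R := by exact_mod_cast (by omega : 1 ≤ R)
  have hη := h.eta_pos
  obtain ⟨t, rfl⟩ : ∃ t : ℝ, s = (Q : ℝ) ^ (-t) :=
    ⟨-Real.logb Q s, by rw [neg_neg, Real.rpow_logb hQ0 hQ1.ne' hs]⟩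
  have ht : 1 ≤ t := by
    have := (Real.rpow_lt_rpow_left_iff hQ1).1 hsQ
    linarith
  set s := (Q : ℝ) ^ (-t) with hsdef
  have hfirst : ∀ i, min 1 (16 * (Q : ℝ) ^ (1 + τ i) * (2 * s + 3 * (R : ℝ) ^ (-(1 + v i - η)))) ≤
      min 1 (80 * ((Q : ℝ) ^ (1 + τ i) * s)) := fun i => by
    have h1 : (R : ℝ) ^ (-(1 + v i - η)) ≤ s :=
      (Real.rpow_le_rpow_of_exponent_le hR1 (by linarith [hv i])).trans hRs
    refine min_le_min_left _ ?_
    calc _ ≤ 16 * (Q : ℝ) ^ (1 + τ i) * (2 * s + 3 * s) := by gcongr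
      _ = _ := by ring
  have hsecond : ∀ i, min 1 (16 * (M : ℝ) ^ (1 + τ i) *
      (2 * s + 3 * (Q : ℝ) ^ (-(1 + v i - η)))) ≤
      48 * (M : ℝ) ^ (1 + τ i) * ((Q : ℝ) ^ η * (s + (Q : ℝ) ^ (-(1 + v i)))) := fun i => by
    have h1 : (Q : ℝ) ^ (-(1 + v i - η)) = (Q : ℝ) ^ η * (Q : ℝ) ^ (-(1 + v i)) := by
      rw [← Real.rpow_add hQ0]
      congr 1
      ring
    have h2 : s ≤ (Q : ℝ) ^ η * s :=
      le_mul_of_one_le_left hs.le (Real.one_le_rpow hQ1.le hη.le)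
    refine (min_le_right _ _).trans ?_
    calc _ ≤ 16 * (M : ℝ) ^ (1 + τ i) *
          (3 * ((Q : ℝ) ^ η * s) + 3 * ((Q : ℝ) ^ η * (Q : ℝ) ^ (-(1 + v i)))) := by
            rw [h1]
            gcongr
            linarith
      _ = _ := by ring
  have hprod1 : ∏ i, min 1 (16 * (Q : ℝ) ^ (1 + τ i) *
      (2 * s + 3 * (R : ℝ) ^ (-(1 + v i - η)))) ≤ ∏ i, min 1 (80 * ((Q : ℝ) ^ (1 + τ i) * s)) :=
    Finset.prod_le_prod (fun i _ => by positivity) fun i _ => hfirst i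
  have hprod2 : ∏ i, min 1 (16 * (M : ℝ) ^ (1 + τ i) *
      (2 * s + 3 * (Q : ℝ) ^ (-(1 + v i - η)))) ≤
      (Q : ℝ) ^ (3 * η) * ∏ i, (s + (Q : ℝ) ^ (-(1 + v i))) := by
    refine (Finset.prod_le_prod (fun i _ => by positivity) fun i _ => hsecond i).trans ?_
    have h1 : ∏ i, 48 * (M : ℝ) ^ (1 + τ i) * ((Q : ℝ) ^ η * (s + (Q : ℝ) ^ (-(1 + v i)))) =
        (∏ i, 48 * (M : ℝ) ^ (1 + τ i)) * ((Q : ℝ) ^ η) ^ 2 *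
          ∏ i, (s + (Q : ℝ) ^ (-(1 + v i))) := by
      simp only [Fin.prod_univ_two]
      ring
    have h2 : (Q : ℝ) ^ (3 * η) = (Q : ℝ) ^ η * ((Q : ℝ) ^ η) ^ 2 := by
      rw [← pow_succ', ← Real.rpow_mul_natCast hQ0.le, mul_comm]
      norm_num
    rw [h1, h2]
    gcongr
  have hmid : (∏ i, min 1 (80 * ((Q : ℝ) ^ (1 + τ i) * s))) *
      ∏ i, (s + (Q : ℝ) ^ (-(1 + v i))) ≤ 25600 * (Q : ℝ) ^ (-((S - ε) * t)) := by
    rw [← Finset.prod_mul_distrib]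
    refine (Finset.prod_le_prod (fun i _ => by positivity) fun i _ =>
      min_one_mul_add_le (K := 80) (a := τ i) (b := v i) (t := t) hQ1.le (by norm_num)).trans ?_
    have h1 := Real.rpow_le_rpow_of_exponent_le hQ1.le (neg_le_neg (hS t ht))
    rw [← Finset.sum_neg_distrib, Real.rpow_sum_of_pos hQ0] at h1
    rw [Finset.prod_mul_distrib, Fin.prod_const]
    linarith
  calc _ ≤ (2 * ∏ i, min 1 (80 * ((Q : ℝ) ^ (1 + τ i) * s))) *
        (2 * ((Q : ℝ) ^ (3 * η) * ∏ i, (s + (Q : ℝ) ^ (-(1 + v i))))) := by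
          gcongr
    _ = 4 * (Q : ℝ) ^ (3 * η) * ((∏ i, min 1 (80 * ((Q : ℝ) ^ (1 + τ i) * s))) *
        ∏ i, (s + (Q : ℝ) ^ (-(1 + v i)))) := by ring
    _ ≤ 4 * (Q : ℝ) ^ (ε * t) * (25600 * (Q : ℝ) ^ (-((S - ε) * t))) := by
        have : (Q : ℝ) ^ (3 * η) ≤ (Q : ℝ) ^ (ε * t) :=
          Real.rpow_le_rpow_of_exponent_le hQ1.le (by nlinarith)
        gcongr
    _ = 102400 * ((Q : ℝ) ^ (ε * t) * (Q : ℝ) ^ (-((S - ε) * t))) := by ring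
    _ = _ := by
        rw [hsdef, ← Real.rpow_add hQ0, ← Real.rpow_mul hQ0.le]
        congr 2
        ring

end Admissible

/-- under the hypotheses of Theorem 2, there is a Borel probability measure `μ`
supported inside `B ∩ B_2(Ψ_τ)` and constants `C, r₀ > 0` with
`μ(F) ≤ C r^{s_ρ - 2ε}` for all balls `F` of radius `r < r₀`, where
`s_ρ = min{(3+τ1-τ2)/(1+τ1), 3/(1+τ2), 1 + ρ2/(1+τ2)}`. -/
theorem stmt2 (τ1 τ2 : ℝ) (hτ : τ2 ≤ τ1) (hτ2 : 0 < τ2) (hsum : 1 < τ1 + τ2)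
    (x : Fin 2 → ℝ) (r : ℝ) (hr : 0 < r)
    (hB : Metric.closedBall x r ⊆ {y : Fin 2 → ℝ | ∀ i, y i ∈ Set.Icc (0:ℝ) 1})
    (ε : ℝ) (hε : 0 < ε)
    (ρ1 ρ2 : ℚ) (hρ1 : 1 ≤ ρ1) (hρ2 : 1 ≤ ρ2) (hρsum : ρ1 + ρ2 = 3) (hρ : ρ2 ≤ ρ1)
    (h1 : 0 < 1 + τ1 - (ρ1 : ℝ)) (h2 : 0 < 1 + τ2 - (ρ2 : ℝ)) :
    ∃ (μ : Measure (Fin 2 → ℝ)) (C r₀ : ℝ),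
      IsProbabilityMeasure μ ∧
      measSupport μ ⊆ Metric.closedBall x r ∩ badSet 2 (psiTau 2 ![τ1, τ2]) ∧
      0 < C ∧ 0 < r₀ ∧
      ∀ (y : Fin 2 → ℝ) (s : ℝ), 0 < s → s < r₀ →
        μ (Metric.closedBall y s) ≤
          ENNReal.ofReal
            (C * s ^ (min (min ((3 + τ1 - τ2) / (1 + τ1)) (3 / (1 + τ2)))
              (1 + (ρ2 : ℝ) / (1 + τ2)) - 2 * ε)) := by
  set S := min ((3 + τ1 - τ2) / (1 + τ1)) (3 / (1 + τ2)) with hSdef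
  obtain ⟨v, w, η, h, hη3, hv, hηv, hS⟩ := exists_isAdmissible (S := S) hτ hτ2 hsum hε
    ((le_div_iff₀ (by linarith)).1 (min_le_left _ _))
    ((le_div_iff₀ (by linarith)).1 (min_le_right _ _))
  set τ : Fin 2 → ℝ := ![τ1, τ2]
  obtain ⟨μ, Qs, hμ, hsupp, hQ0, hQs, hP, hball⟩ := exists_measure_on_badSet h
    (P := fun M Q => 2 ≤ Q ∧ ∏ i, 48 * (M : ℝ) ^ (1 + τ i) ≤ (Q : ℝ) ^ η)
    (fun M => (Filter.eventually_ge_atTop 2).and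
      ((tendsto_natCast_rpow h.eta_pos).eventually_ge_atTop _)) hr hB
  have hQ1 : 0 < Qs 1 := hQ0.trans (hQs one_pos)
  have hc : 0 < 1 + v 1 - η := by linarith
  refine ⟨μ, 102400, (Qs 1 : ℝ) ^ (-(1 + v 1 - η)), hμ, hsupp, by norm_num, by positivity,
    fun y s hs hs1 => ?_⟩
  have hs_one : s ≤ 1 := hs1.le.trans
    (Real.rpow_le_one_of_one_le_of_nonpos (by exact_mod_cast hQ1) (by linarith))
  obtain ⟨n, hn1, hn2⟩ := exists_between_scales hQs hc hs hs1
  refine ((measure_mono (Metric.closedBall_subset_ball (by linarith : s < 2 * s))).trans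
    (hball n y (2 * s) (by positivity))).trans ?_
  rw [← ENNReal.ofReal_mul
    (mul_nonneg zero_le_two (Finset.prod_nonneg fun i _ => by positivity))]
  refine ENNReal.ofReal_le_ofReal ((prod_mul_prod_le h hη3 hv hηv hS (hP n).1 (hP (n + 1)).1
    (hP n).2 hs hn1 hn2).trans ?_)
  refine mul_le_mul_of_nonneg_left ?_ (by norm_num)
  exact Real.rpow_le_rpow_of_exponent_ge hs hs_one (sub_le_sub_right (min_le_left _ _) _)
end
end

section
/- (Weighted Dirichlet theorem) Let m ≥ 1 and let a_1, …, a_m be real numbers with a_i ≥ 1 for each i and a_1 + ⋯ + a_m = m + 1. Then for any x = (x_1, …, x_m) ∈ ℝ^m, there exist infinitely many positive integers q such that for some integers p_1, …, p_m one has |x_i − p_i/q| < q^{−a_i} for i = 1, …, m. -/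
open Set

open MeasureTheory Module in
/-- Minkowski's theorem on linear forms, with strict inequalities. -/
theorem exists_ne_zero_int_abs_mulVec_lt {ι : Type*} [Fintype ι] [DecidableEq ι]
    (A : Matrix ι ι ℝ) (hA : A.det ≠ 0) (c : ι → ℝ) (hc : ∀ i, 0 < c i)
    (h : |A.det| < ∏ i, c i) :
    ∃ z : ι → ℤ, z ≠ 0 ∧ ∀ i, |A.mulVec (fun j => (z j : ℝ)) i| < c i := by
  let b := Pi.basisFun ℝ ι
  let box : Set (ι → ℝ) := univ.pi fun i => Ioo (-c i) (c i)
  let f := Matrix.toLin' A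
  have hf : LinearMap.det f ≠ 0 := by simpa [f] using hA
  have hvol : volume (ZSpan.fundamentalDomain b) * 2 ^ finrank ℝ (ι → ℝ)
      < volume (f ⁻¹' box) := by
    have hbox : volume box = ENNReal.ofReal (2 ^ Fintype.card ι * ∏ i, c i) := by
      rw [Real.volume_pi_Ioo, ← ENNReal.ofReal_prod_of_nonneg fun i _ => by linarith [hc i]]
      congr 1
      simp_rw [sub_neg_eq_add, ← two_mul, Finset.prod_mul_distrib]
      simp
    have hfund : volume (ZSpan.fundamentalDomain b) = 1 := by
      have hb : Matrix.of b = 1 := by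
        ext i j
        simp [b, Matrix.one_apply, Pi.single_apply, eq_comm]
      rw [ZSpan.volume_fundamentalDomain, hb]
      simp
    have htwo : (2 : ENNReal) ^ finrank ℝ (ι → ℝ) = ENNReal.ofReal (2 ^ Fintype.card ι) := by
      rw [finrank_fintype_fun_eq_card, ENNReal.ofReal_pow zero_le_two]
      simp
    have hdet : 0 < |A.det| := abs_pos.2 hA
    rw [hfund, Measure.addHaar_preimage_linearMap _ hf, hbox, one_mul, htwo,
      ← ENNReal.ofReal_mul (abs_nonneg _)]
    have hpos : (0 : ℝ) < 2 ^ Fintype.card ι := by positivity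
    have hprod : 0 < ∏ i, c i := hdet.trans h
    have hlt : (2 : ℝ) ^ Fintype.card ι <
        |(LinearMap.det f)⁻¹| * (2 ^ Fintype.card ι * ∏ i, c i) := by
      rw [LinearMap.det_toLin', abs_inv, ← div_eq_inv_mul, lt_div_iff₀ hdet]
      gcongr
    exact (ENNReal.ofReal_lt_ofReal_iff (hpos.trans hlt)).2 hlt
  have hfund := ZSpan.isAddFundamentalDomain' b volume
  have : Countable (Submodule.span ℤ (Set.range b)).toAddSubgroup := by
    change Countable (Submodule.span ℤ (Set.range b))
    infer_instance
  obtain ⟨⟨v, hv⟩, hv0, hvs⟩ := exists_ne_zero_mem_lattice_of_measure_mul_two_pow_lt_measure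
    hfund (s := f ⁻¹' box)
    (fun v hv i hi => by
      have := hv i hi
      simp only [map_neg, Pi.neg_apply, mem_Ioo] at this ⊢
      constructor <;> linarith)
    ((convex_pi fun i _ => convex_Ioo _ _).linear_preimage f) hvol
  choose z hz using (b.mem_span_iff_repr_mem ℤ v).1 hv
  have hvz : v = fun j => (z j : ℝ) := by
    ext j
    simpa [b] using (hz j).symm
  refine ⟨z, ?_, fun i => ?_⟩
  · rintro rfl
    exact hv0 (Subtype.ext (hvz.trans (by ext; simp)))
  · rw [abs_lt, ← hvz]
    simpa [f] using hvs i (mem_univ i)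

/-- Simultaneous Dirichlet approximation with a separate tolerance for each coordinate. -/
theorem exists_nat_forall_abs_mul_sub_lt {m : ℕ} (x δ : Fin m → ℝ) (hδ : ∀ i, 0 < δ i)
    (hδ' : ∀ i, δ i ≤ 1) (Q : ℕ) (h : 1 < (Q + 1 : ℝ) * ∏ i, δ i) :
    ∃ q : ℕ, 0 < q ∧ q ≤ Q ∧ ∃ p : Fin m → ℤ, ∀ i, |q * x i - p i| < δ i := by
  let A : Matrix (Fin (m + 1)) (Fin (m + 1)) ℝ :=
    1 + Matrix.replicateCol Unit (Fin.cons 0 (-x) : Fin (m + 1) → ℝ) *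
      Matrix.replicateRow Unit (Pi.single 0 1 : Fin (m + 1) → ℝ)
  have hdet : A.det = 1 := by
    simp [A, Matrix.det_one_add_replicateCol_mul_replicateRow]
  have hA (v : Fin (m + 1) → ℝ) (i : Fin (m + 1)) :
      A.mulVec v i = v i + (Fin.cons 0 (-x) : Fin (m + 1) → ℝ) i * v 0 := by
    simp only [A, Matrix.add_mulVec, Matrix.one_mulVec, ← Matrix.mulVec_mulVec, Pi.add_apply]
    simp [Matrix.mulVec, dotProduct, Pi.single_apply]
  obtain ⟨z, hz0, hz⟩ := exists_ne_zero_int_abs_mulVec_lt A (by simp [hdet])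
    (Fin.cons (Q + 1 : ℝ) δ) (Fin.cases (by simp; positivity) hδ)
    (by simpa [hdet, Fin.prod_univ_succ] using h)
  have hzQ : |(z 0 : ℝ)| < Q + 1 := by simpa [hA] using hz 0
  have hzδ (i : Fin m) : |(z i.succ : ℝ) - x i * z 0| < δ i := by
    simpa [hA, ← sub_eq_add_neg] using hz i.succ
  have hz1 : z 0 ≠ 0 := by
    intro h0
    refine hz0 (funext (Fin.cases h0 fun i => ?_))
    have : |(z i.succ : ℝ)| < 1 := by simpa [h0] using (hzδ i).trans_le (hδ' i)
    exact Int.abs_lt_one_iff.1 (by exact_mod_cast this)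
  refine ⟨(z 0).natAbs, Int.natAbs_pos.2 hz1, ?_, fun i => (z 0).sign * z i.succ, fun i => ?_⟩
  · have : |z 0| < Q + 1 := by exact_mod_cast hzQ
    rw [Int.abs_eq_natAbs] at this
    omega
  · rw [Nat.cast_natAbs, ← Int.sign_mul_self_eq_abs]
    push_cast
    rw [show ((z 0).sign : ℝ) * z 0 * x i - (z 0).sign * z i.succ =
      (z 0).sign * -(z i.succ - x i * z 0) by ring, abs_mul, abs_neg, ← Int.cast_abs,
      Int.abs_sign_of_ne_zero hz1]
    simpa using hzδ i

theorem abs_sub_div_lt_rpow_neg {x a p : ℝ} {q : ℕ} (hq : 0 < q)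
    (h : |q * x - p| < (q : ℝ) ^ (-(a - 1))) : |x - p / q| < (q : ℝ) ^ (-a) := by
  have hq' : (0 : ℝ) < q := by exact_mod_cast hq
  rw [show x - p / q = (q * x - p) / q by field_simp, abs_div, abs_of_pos hq', div_lt_iff₀ hq']
  rwa [show -(a - 1) = -a + 1 by ring, Real.rpow_add_one hq'.ne'] at h

/-- Weighted Dirichlet theorem: if `a_i ≥ 1` for all `i` and
`a_1 + ⋯ + a_m = m + 1`, then for any `x ∈ ℝ^m` there are infinitely many positive integers
`q` such that for some integers `p_1, …, p_m` one has `|x_i - p_i / q| < q^{-a_i}` for all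
`i`. -/
theorem stmt4 (m : ℕ) (hm : 1 ≤ m) (a : Fin m → ℝ) (ha : ∀ i, 1 ≤ a i)
    (hsum : ∑ i, a i = m + 1) (x : Fin m → ℝ) :
    {q : ℕ | 0 < q ∧ ∃ p : Fin m → ℤ,
      ∀ i, |x i - (p i : ℝ) / (q : ℝ)| < (q : ℝ) ^ (-(a i))}.Infinite := by
  by_cases hx : ∃ q : ℕ, 0 < q ∧ ∀ i, a i = 1 ∨ ∃ p : ℤ, (q : ℝ) * x i = p
  · obtain ⟨q, hq, hqx⟩ := hx
    refine infinite_of_injective_forall_mem (f := fun k : ℕ => (k + 1) * q)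
      (fun k l hkl => by simpa [hq.ne'] using hkl) fun k => ?_
    have hkq : 0 < (k + 1) * q := by positivity
    refine ⟨hkq, fun i => round ((((k + 1) * q : ℕ) : ℝ) * x i), fun i =>
      abs_sub_div_lt_rpow_neg hkq ?_⟩
    rcases hqx i with hi | ⟨p, hp⟩
    · rw [hi]
      simpa using (abs_sub_round _).trans_lt (by norm_num : (1 / 2 : ℝ) < 1)
    · have : (((k + 1) * q : ℕ) : ℝ) * x i = (((k + 1) * p : ℤ) : ℝ) := by
        push_cast
        rw [mul_assoc, hp]
      beta_reduce
      rw [this, round_intCast, sub_self, abs_zero]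
      exact Real.rpow_pos_of_pos (by exact_mod_cast hkq) _
  · push Not at hx
    intro hfin
    have hev (q : ℕ) (hq : 0 < q) : ∀ᶠ Q : ℕ in Filter.atTop,
        ∀ p : Fin m → ℤ, ∃ i, (Q : ℝ) ^ (-(a i - 1)) ≤ |q * x i - p i| := by
      obtain ⟨i, hi, hp⟩ := hx q hq
      have hpos : 0 < |q * x i - round (q * x i)| := abs_pos.2 (sub_ne_zero.2 (hp _))
      have hlim := (tendsto_rpow_neg_atTop (sub_pos.2 ((ha i).lt_of_ne' hi))).comp
        tendsto_natCast_atTop_atTop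
      filter_upwards [hlim.eventually_lt_const hpos] with Q hQ p
      exact ⟨i, hQ.le.trans (round_le _ _)⟩
    obtain ⟨Q, hQ, hQ1⟩ := (((Filter.eventually_all_finite hfin).2
      fun q hq => hev q hq.1).and (Filter.eventually_ge_atTop 1)).exists
    have hQ0 : (0 : ℝ) < Q := by exact_mod_cast hQ1
    have hprod : ∏ i, (Q : ℝ) ^ (-(a i - 1)) = (Q : ℝ)⁻¹ := by
      rw [← Real.rpow_sum_of_pos hQ0, ← Real.rpow_neg_one]
      congr 1
      simp [hsum]
    obtain ⟨q, hq, hqQ, p, hp⟩ := exists_nat_forall_abs_mul_sub_lt x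
      (fun i => (Q : ℝ) ^ (-(a i - 1))) (fun i => Real.rpow_pos_of_pos hQ0 _)
      (fun i => Real.rpow_le_one_of_one_le_of_nonpos (by exact_mod_cast hQ1)
        (by linarith [ha i])) Q
      (by rw [hprod, ← div_eq_mul_inv, lt_div_iff₀ hQ0]; linarith)
    have hqS : q ∈ {q : ℕ | 0 < q ∧ ∃ p : Fin m → ℤ,
        ∀ i, |x i - (p i : ℝ) / (q : ℝ)| < (q : ℝ) ^ (-(a i))} :=
      ⟨hq, p, fun i => abs_sub_div_lt_rpow_neg hq ((hp i).trans_le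
        (Real.rpow_le_rpow_of_nonpos (by exact_mod_cast hq) (by exact_mod_cast hqQ)
          (by linarith [ha i])))⟩
    obtain ⟨i, hi⟩ := hQ q hqS p
    exact (hp i).not_ge hi
end

section
/- Let τ1 > 1 and τ = (τ1, 0). Then a point x = (x1, x2) ∈ [0,1]² belongs to B_2(Ψ_τ) if and only if x1 ∈ B_1(Ψ_{τ1}); equivalently, B_2(Ψ_τ) = B_1(Ψ_{τ1}) × [0,1]. -/
open MeasureTheory Set

noncomputable section

/-- The one-dimensional set of ψ-approximable numbers in `[0,1]`. -/
def approxSet1 (ψ : ℕ → ℝ) : Set ℝ :=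
  {x | x ∈ Set.Icc (0:ℝ) 1 ∧
    {q : ℕ | 0 < q ∧ ∃ p : ℤ, |(q : ℝ) * x - (p : ℝ)| < ψ q}.Infinite}

/-- The one-dimensional set of weighted ψ-badly approximable numbers. -/
def badSet1 (ψ : ℕ → ℝ) : Set ℝ :=
  approxSet1 ψ \ ⋂ c ∈ Set.Ioo (0:ℝ) 1, approxSet1 (fun q => c * ψ q)

/-- When the second exponent is zero, the second coordinate imposes no condition on
`Ψ_τ`-approximability. -/
lemma mem_approxSet_psiTau_zero_iff (t : ℝ) (x : Fin 2 → ℝ) (hx : x 1 ∈ Set.Icc (0:ℝ) 1) :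
    x ∈ approxSet 2 (psiTau 2 ![t, 0]) ↔ x 0 ∈ approxSet1 (fun q => (q : ℝ) ^ (-t)) := by
  constructor
  · rintro ⟨h01, hinf⟩
    refine ⟨h01 0, hinf.mono ?_⟩
    rintro q ⟨hq, p, hp⟩
    exact ⟨hq, p 0, by simpa [psiTau] using hp 0⟩
  · rintro ⟨h0, hinf⟩
    refine ⟨by simpa [Fin.forall_fin_two] using ⟨h0, hx⟩, hinf.mono ?_⟩
    rintro q ⟨hq, p, hp⟩
    refine ⟨hq, ![p, round ((q : ℝ) * x 1)], Fin.forall_fin_two.2 ⟨by simpa [psiTau] using hp, ?_⟩⟩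
    have := abs_sub_round ((q : ℝ) * x 1)
    simp only [psiTau, Matrix.cons_val_one, Matrix.cons_val_fin_one, neg_zero, Real.rpow_zero]
    linarith

lemma mem_approxSet1_of_mem_approxSet_mul_psiTau {t c : ℝ} {x : Fin 2 → ℝ}
    (h : x ∈ approxSet 2 (fun q i => c * psiTau 2 ![t, 0] q i)) :
    x 0 ∈ approxSet1 (fun q => c * (q : ℝ) ^ (-t)) := by
  obtain ⟨h01, hinf⟩ := h
  refine ⟨h01 0, hinf.mono ?_⟩
  rintro q ⟨hq, p, hp⟩
  exact ⟨hq, p 0, by simpa [psiTau] using hp 0⟩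

/-- If `x 0` is approximable with every constant, then so is `x`: multiply each denominator by a
bounded factor supplied by Dirichlet's theorem for the second coordinate. -/
lemma mem_approxSet_mul_psiTau_zero {t : ℝ} (ht : 0 ≤ t) {x : Fin 2 → ℝ}
    (hx : x 1 ∈ Set.Icc (0:ℝ) 1)
    (h : ∀ c ∈ Set.Ioo (0:ℝ) 1, x 0 ∈ approxSet1 (fun q => c * (q : ℝ) ^ (-t)))
    {c : ℝ} (hc : c ∈ Set.Ioo (0:ℝ) 1) :
    x ∈ approxSet 2 (fun q i => c * psiTau 2 ![t, 0] q i) := by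
  obtain ⟨hc0, hc1⟩ := hc
  obtain ⟨N, hN⟩ := exists_nat_one_div_lt hc0
  have hN0 : 0 < N := by
    rcases Nat.eq_zero_or_pos N with rfl | hN0
    · norm_num at hN
      linarith
    · exact hN0
  have hN1 : (1:ℝ) ≤ N := by exact_mod_cast hN0
  have hNt0 : 0 < (N : ℝ) ^ (-t) := Real.rpow_pos_of_pos (by linarith) _
  have hNt1 : (N : ℝ) ^ (-t) ≤ 1 := Real.rpow_le_one_of_one_le_of_nonpos hN1 (by linarith)
  set d : ℝ := c * (N : ℝ) ^ (-t) / N with hd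
  have hd0 : 0 < d := by positivity
  have hd1 : d < 1 := by
    rw [hd, div_lt_one (by linarith)]
    nlinarith
  obtain ⟨h0, hinf⟩ := h d ⟨hd0, hd1⟩
  refine ⟨by simpa [Fin.forall_fin_two] using ⟨h0, hx⟩, ?_⟩
  refine Set.infinite_of_forall_exists_gt fun a => ?_
  obtain ⟨q, ⟨hq, p, hp⟩, haq⟩ := hinf.exists_gt a
  obtain ⟨k, hk0, hkN, hk⟩ := Real.exists_nat_abs_mul_sub_round_le ((q : ℝ) * x 1) hN0
  have hk0' : (0:ℝ) < k := by exact_mod_cast hk0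
  have hq0' : (0:ℝ) < q := by exact_mod_cast hq
  have hkN' : (k:ℝ) ≤ N := by exact_mod_cast hkN
  refine ⟨k * q, ⟨Nat.mul_pos hk0 hq, ![k * p, round ((k : ℝ) * ((q : ℝ) * x 1))],
    Fin.forall_fin_two.2 ⟨?_, ?_⟩⟩, haq.trans_le (Nat.le_mul_of_pos_left q hk0)⟩
  · simp only [psiTau, Matrix.cons_val_zero]
    push_cast
    calc |(k:ℝ) * q * x 0 - k * p| = k * |q * x 0 - p| := by
          rw [← abs_of_pos hk0', ← abs_mul, abs_of_pos hk0']
          ring_nf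
      _ < k * (d * (q:ℝ) ^ (-t)) := by gcongr
      _ ≤ N * (d * (q:ℝ) ^ (-t)) := by gcongr
      _ = c * ((N:ℝ) ^ (-t) * (q:ℝ) ^ (-t)) := by
          rw [hd]
          field_simp
      _ ≤ c * ((k:ℝ) ^ (-t) * (q:ℝ) ^ (-t)) := by
          have := Real.rpow_le_rpow_of_nonpos hk0' hkN' (neg_nonpos.2 ht)
          gcongr
      _ = c * ((k:ℝ) * q) ^ (-t) := by rw [Real.mul_rpow hk0'.le hq0'.le]
  · simp only [psiTau, Matrix.cons_val_one, Matrix.cons_val_fin_one, neg_zero, Real.rpow_zero,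
      mul_one]
    push_cast
    rw [mul_assoc]
    exact hk.trans_lt hN

lemma mem_badSet_psiTau_zero_iff {t : ℝ} (ht : 0 ≤ t) (x : Fin 2 → ℝ)
    (hx : x 1 ∈ Set.Icc (0:ℝ) 1) :
    x ∈ badSet 2 (psiTau 2 ![t, 0]) ↔ x 0 ∈ badSet1 (fun q => (q : ℝ) ^ (-t)) := by
  simp only [badSet, badSet1, Set.mem_sdiff, Set.mem_iInter]
  rw [mem_approxSet_psiTau_zero_iff t x hx]
  refine and_congr_right fun _ => not_congr ⟨fun h c hc => ?_, fun h c hc => ?_⟩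
  · exact mem_approxSet1_of_mem_approxSet_mul_psiTau (h c hc)
  · exact mem_approxSet_mul_psiTau_zero ht hx h hc

/-- for `τ1 > 1` and `τ = (τ1, 0)`, a point `x ∈ [0,1]²` lies in `B_2(Ψ_τ)` iff
`x 0 ∈ B_1(Ψ_{τ1})`; equivalently `B_2(Ψ_τ) = B_1(Ψ_{τ1}) × [0,1]`. -/
theorem stmt7 (τ1 : ℝ) (hτ1 : 1 < τ1) :
    (∀ x : Fin 2 → ℝ, (∀ i, x i ∈ Set.Icc (0:ℝ) 1) →
      (x ∈ badSet 2 (psiTau 2 ![τ1, 0]) ↔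
        x 0 ∈ badSet1 (fun q => (q : ℝ) ^ (-τ1)))) ∧
    badSet 2 (psiTau 2 ![τ1, 0]) =
      {x : Fin 2 → ℝ | x 0 ∈ badSet1 (fun q => (q : ℝ) ^ (-τ1)) ∧
        x 1 ∈ Set.Icc (0:ℝ) 1} := by
  have ht : 0 ≤ τ1 := by linarith
  refine ⟨fun x hx => mem_badSet_psiTau_zero_iff ht x (hx 1), Set.ext fun x => ?_⟩
  constructor
  · intro h
    have hx := h.1.1 1
    exact ⟨(mem_badSet_psiTau_zero_iff ht x hx).1 h, hx⟩
  · rintro ⟨h, hx⟩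
    exact (mem_badSet_psiTau_zero_iff ht x hx).2 h
end
end

section
/- Let τ = (τ1, τ2) with τ1 ≥ τ2 > 0 and τ1 + τ2 > 1. For any κ > 0 there exist constants c1, c2 > 0 and a compact set C ⊆ [0,1]² with two-dimensional Lebesgue measure λ(C) ≥ 1 − κ, such that for every rational point (p1/q, p2/q) ∈ ℚ² ∩ [0,1]² (p1, p2 ∈ ℤ, q a positive integer), C ∩ ([p1/q − c1·q^{−1−τ1}, p1/q + c1·q^{−1−τ1}] × [p2/q − c2·q^{−1−τ2}, p2/q + c2·q^{−1−τ2}]) = ∅. -/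
open MeasureTheory Set

/-- The open box of radii `r * q ^ (-(1 + τ i))` around the rational point `p / q`. -/
def rationalBox (τ : Fin 2 → ℝ) (r : ℝ) (q : ℕ) (p : ℕ × ℕ) : Set (Fin 2 → ℝ) :=
  Set.univ.pi fun i => Set.Ioo
    ((![p.1, p.2] i : ℝ) / q - r * (q : ℝ) ^ (-(1 + τ i)))
    ((![p.1, p.2] i : ℝ) / q + r * (q : ℝ) ^ (-(1 + τ i)))

/-- The union of the boxes `rationalBox τ r q p` over all `p / q` in the unit square. -/
def rationalBoxes (τ : Fin 2 → ℝ) (r : ℝ) : Set (Fin 2 → ℝ) :=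
  ⋃ q : ℕ, ⋃ p ∈ Finset.range (q + 1) ×ˢ Finset.range (q + 1), rationalBox τ r q p

lemma isOpen_rationalBox (τ : Fin 2 → ℝ) (r : ℝ) (q : ℕ) (p : ℕ × ℕ) :
    IsOpen (rationalBox τ r q p) :=
  isOpen_set_pi Set.finite_univ fun _ _ => isOpen_Ioo

lemma isOpen_rationalBoxes (τ : Fin 2 → ℝ) (r : ℝ) : IsOpen (rationalBoxes τ r) :=
  isOpen_iUnion fun q => isOpen_biUnion fun p _ => isOpen_rationalBox τ r q p

lemma volume_rationalBox (τ : Fin 2 → ℝ) {r : ℝ} (hr : 0 ≤ r) {q : ℕ} (hq : 0 < q)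
    (p : ℕ × ℕ) :
    volume (rationalBox τ r q p) =
      ENNReal.ofReal (4 * r ^ 2 * (q : ℝ) ^ (-(2 + (τ 0 + τ 1)))) := by
  have hq' : (0 : ℝ) < q := by exact_mod_cast hq
  rw [rationalBox, Real.volume_pi_Ioo, Fin.prod_univ_two, ← ENNReal.ofReal_mul (by
    have : 0 ≤ r * (q : ℝ) ^ (-(1 + τ 0)) := by positivity
    linarith)]
  congr 1
  rw [show -(2 + (τ 0 + τ 1)) = -(1 + τ 0) + -(1 + τ 1) by ring, Real.rpow_add hq']
  ring

lemma volume_iUnion_rationalBox_le {τ : Fin 2 → ℝ} (hτ : ∀ i, 0 < τ i) {r : ℝ} (hr : 0 ≤ r)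
    (q : ℕ) :
    volume (⋃ p ∈ Finset.range (q + 1) ×ˢ Finset.range (q + 1), rationalBox τ r q p) ≤
      ENNReal.ofReal (16 * r ^ 2 * (q : ℝ) ^ (-(τ 0 + τ 1))) := by
  rcases Nat.eq_zero_or_pos q with rfl | hq
  · have h : (-(1 + τ 0)) ≠ 0 := by linarith [hτ 0]
    refine (measure_biUnion_finset_le _ _).trans ?_
    simp [rationalBox, Real.volume_pi_Ioo, Real.zero_rpow h, -neg_add_rev]
  · have hq' : (1 : ℝ) ≤ q := by exact_mod_cast hq
    refine (measure_biUnion_finset_le _ _).trans ?_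
    simp only [volume_rationalBox τ hr hq, Finset.sum_const, Finset.card_product,
      Finset.card_range, nsmul_eq_mul]
    rw [← ENNReal.ofReal_natCast, ← ENNReal.ofReal_mul (by positivity)]
    refine ENNReal.ofReal_le_ofReal ?_
    have h : (q : ℝ) ^ (-(τ 0 + τ 1)) = (q : ℝ) ^ 2 * (q : ℝ) ^ (-(2 + (τ 0 + τ 1))) := by
      rw [← Real.rpow_natCast, ← Real.rpow_add (by linarith)]
      congr 1
      push_cast
      ring
    have hcount : ((q : ℝ) + 1) * (q + 1) ≤ 4 * (q : ℝ) ^ 2 := by nlinarith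
    push_cast
    rw [h]
    calc ((q : ℝ) + 1) * (q + 1) * (4 * r ^ 2 * (q : ℝ) ^ (-(2 + (τ 0 + τ 1))))
        ≤ 4 * (q : ℝ) ^ 2 * (4 * r ^ 2 * (q : ℝ) ^ (-(2 + (τ 0 + τ 1)))) := by gcongr
      _ = _ := by ring

lemma volume_rationalBoxes_le {τ : Fin 2 → ℝ} (hτ : ∀ i, 0 < τ i) (hsum : 1 < τ 0 + τ 1)
    {r : ℝ} (hr : 0 ≤ r) :
    volume (rationalBoxes τ r) ≤
      ENNReal.ofReal (16 * r ^ 2 * ∑' q : ℕ, (q : ℝ) ^ (-(τ 0 + τ 1))) := by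
  have hs : Summable fun q : ℕ => (q : ℝ) ^ (-(τ 0 + τ 1)) :=
    Real.summable_nat_rpow.2 (by linarith)
  rw [← tsum_mul_left, ENNReal.ofReal_tsum_of_nonneg (fun q => by positivity) (hs.mul_left _)]
  exact (measure_iUnion_le _).trans
    (ENNReal.tsum_le_tsum fun q => volume_iUnion_rationalBox_le hτ hr q)

lemma exists_natCast_eq_of_div_mem_Icc {p : ℤ} {q : ℕ} (hq : 0 < q)
    (h : (p : ℝ) / q ∈ Set.Icc (0 : ℝ) 1) : ∃ n ∈ Finset.range (q + 1), (n : ℝ) = p := by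
  have hq' : (0 : ℝ) < q := by exact_mod_cast hq
  have h0 : (0 : ℝ) ≤ p := by simpa using (le_div_iff₀ hq').1 h.1
  have h1 : (p : ℝ) ≤ q := by simpa using (div_le_iff₀ hq').1 h.2
  lift p to ℕ using by exact_mod_cast h0
  exact ⟨p, Finset.mem_range.2 (Nat.lt_succ_of_le (by exact_mod_cast h1)), by simp⟩

/-- for `τ1 ≥ τ2 > 0` with `τ1 + τ2 > 1` and any `κ > 0`, there are constants
`c1, c2 > 0` and a compact `C ⊆ [0,1]²` with `λ(C) ≥ 1 - κ` avoiding, for every rational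
point `(p1/q, p2/q) ∈ [0,1]²`, the rectangle
`[p1/q − c1 q^{−1−τ1}, p1/q + c1 q^{−1−τ1}] × [p2/q − c2 q^{−1−τ2}, p2/q + c2 q^{−1−τ2}]`. -/
theorem stmt9 (τ1 τ2 : ℝ) (hτ : τ2 ≤ τ1) (hτ2 : 0 < τ2) (hsum : 1 < τ1 + τ2)
    (κ : ℝ) (hκ : 0 < κ) :
    ∃ (c1 c2 : ℝ) (C : Set (Fin 2 → ℝ)),
      0 < c1 ∧ 0 < c2 ∧ IsCompact C ∧
      C ⊆ {x : Fin 2 → ℝ | ∀ i, x i ∈ Set.Icc (0:ℝ) 1} ∧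
      ENNReal.ofReal (1 - κ) ≤ volume C ∧
      ∀ (p1 p2 : ℤ) (q : ℕ), 0 < q →
        (p1 : ℝ) / (q : ℝ) ∈ Set.Icc (0:ℝ) 1 → (p2 : ℝ) / (q : ℝ) ∈ Set.Icc (0:ℝ) 1 →
        C ∩ {x : Fin 2 → ℝ |
          |x 0 - (p1 : ℝ) / (q : ℝ)| ≤ c1 * (q : ℝ) ^ (-(1 + τ1)) ∧
          |x 1 - (p2 : ℝ) / (q : ℝ)| ≤ c2 * (q : ℝ) ^ (-(1 + τ2))} = ∅ := by
  set S : ℝ := ∑' q : ℕ, (q : ℝ) ^ (-(τ1 + τ2))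
  have hS0 : 0 ≤ S := tsum_nonneg fun q => by positivity
  set c : ℝ := √(κ / (64 * (S + 1)))
  have hc0 : 0 < c := by positivity
  have hcS : 16 * (2 * c) ^ 2 * S ≤ κ := by
    have hc2 : c ^ 2 = κ / (64 * (S + 1)) := Real.sq_sqrt (by positivity)
    rw [mul_pow, hc2]
    field_simp
    nlinarith
  set τ : Fin 2 → ℝ := ![τ1, τ2] with hτdef
  have hτpos : ∀ i, 0 < τ i := by
    rw [Fin.forall_fin_two]
    exact ⟨hτ2.trans_le hτ, hτ2⟩
  have hvol : volume (rationalBoxes τ (2 * c)) ≤ ENNReal.ofReal κ :=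
    (volume_rationalBoxes_le hτpos hsum (by positivity)).trans (ENNReal.ofReal_le_ofReal hcS)
  refine ⟨c, c, Set.Icc 0 1 \ rationalBoxes τ (2 * c), hc0, hc0,
    isCompact_Icc.diff (isOpen_rationalBoxes τ _), ?_, ?_, ?_⟩
  · exact fun x hx i => ⟨hx.1.1 i, hx.1.2 i⟩
  · have hcube : volume (Set.Icc (0 : Fin 2 → ℝ) 1) = 1 := by simp [Real.volume_Icc_pi]
    calc ENNReal.ofReal (1 - κ) = 1 - ENNReal.ofReal κ := by
          rw [ENNReal.ofReal_sub _ hκ.le, ENNReal.ofReal_one]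
      _ ≤ volume (Set.Icc (0 : Fin 2 → ℝ) 1) - volume (rationalBoxes τ (2 * c)) := by
          rw [hcube]
          exact tsub_le_tsub_left hvol 1
      _ ≤ _ := le_measure_sdiff
  · intro p1 p2 q hq hp1 hp2
    obtain ⟨n1, hn1, h1⟩ := exists_natCast_eq_of_div_mem_Icc hq hp1
    obtain ⟨n2, hn2, h2⟩ := exists_natCast_eq_of_div_mem_Icc hq hp2
    rw [Set.eq_empty_iff_forall_notMem]
    rintro x ⟨⟨-, hx⟩, hx1, hx2⟩
    refine hx (Set.mem_iUnion.2 ⟨q, Set.mem_iUnion₂.2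
      ⟨(n1, n2), Finset.mk_mem_product hn1 hn2, ?_⟩⟩)
    have hq' : (0 : ℝ) < q := by exact_mod_cast hq
    have hpos : ∀ t : ℝ, 0 < c * (q : ℝ) ^ t := fun t => by positivity
    have hlt1 := abs_lt.1 (hx1.trans_lt (lt_two_mul_self (hpos _)))
    have hlt2 := abs_lt.1 (hx2.trans_lt (lt_two_mul_self (hpos _)))
    rw [rationalBox, Set.mem_univ_pi, Fin.forall_fin_two]
    simp only [Set.mem_Ioo, hτdef, Matrix.cons_val_zero, Matrix.cons_val_one, h1, h2, mul_assoc]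
    exact ⟨⟨by linarith, by linarith⟩, ⟨by linarith, by linarith⟩⟩
end

section
/- Let τ1, τ2 ≥ 0 and ρ1 ≥ ρ2 ≥ 1 with ρ_i ≤ 1 + τ_i for i = 1, 2. Let q, q' be positive integers and p, p' ∈ ℤ². Suppose the rectangles Δ(p/q, (3q^{−ρ1}, 3q^{−ρ2})) and Δ(p'/q', (3q'^{−ρ1}, 3q'^{−ρ2})) are disjoint. If a closed ball B(x, r) in the supremum metric intersects both Δ(p/q, (q^{−1−τ1}, q^{−1−τ2})) and Δ(p'/q', (q'^{−1−τ1}, q'^{−1−τ2})), then r ≥ q^{−ρ1}. -/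
open Set

noncomputable section

/-- The rectangle `Δ(z, (e1, e2)) = [z1-e1, z1+e1] × [z2-e2, z2+e2]` in `ℝ²`. -/
def delta2 (z : Fin 2 → ℝ) (e1 e2 : ℝ) : Set (Fin 2 → ℝ) :=
  {x | |x 0 - z 0| ≤ e1 ∧ |x 1 - z 1| ≤ e2}

/-- with `τ1, τ2 ≥ 0`, `ρ1 ≥ ρ2 ≥ 1`, `ρᵢ ≤ 1 + τᵢ`, if the enlarged
rectangles `Δ(p/q, (3q^{-ρ1}, 3q^{-ρ2}))` and `Δ(p'/q', (3q'^{-ρ1}, 3q'^{-ρ2}))` are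
disjoint and a closed sup-metric ball `B(x,r)` meets both shrunk rectangles
`Δ(p/q, (q^{-1-τ1}, q^{-1-τ2}))` and `Δ(p'/q', (q'^{-1-τ1}, q'^{-1-τ2}))`, then
`r ≥ q^{-ρ1}`. -/
theorem stmt11 (τ1 τ2 : ℝ) (hτ1 : 0 ≤ τ1) (hτ2 : 0 ≤ τ2)
    (ρ1 ρ2 : ℝ) (hρ : ρ2 ≤ ρ1) (hρ2 : 1 ≤ ρ2)
    (hb1 : ρ1 ≤ 1 + τ1) (hb2 : ρ2 ≤ 1 + τ2)
    (q q' : ℕ) (hq : 0 < q) (hq' : 0 < q') (p p' : Fin 2 → ℤ)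
    (hdisj : Disjoint
      (delta2 (fun i => (p i : ℝ) / (q : ℝ)) (3 * (q : ℝ) ^ (-ρ1)) (3 * (q : ℝ) ^ (-ρ2)))
      (delta2 (fun i => (p' i : ℝ) / (q' : ℝ))
        (3 * (q' : ℝ) ^ (-ρ1)) (3 * (q' : ℝ) ^ (-ρ2))))
    (x : Fin 2 → ℝ) (r : ℝ)
    (hmeet : (Metric.closedBall x r ∩
      delta2 (fun i => (p i : ℝ) / (q : ℝ))
        ((q : ℝ) ^ (-(1 + τ1))) ((q : ℝ) ^ (-(1 + τ2)))).Nonempty)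
    (hmeet' : (Metric.closedBall x r ∩
      delta2 (fun i => (p' i : ℝ) / (q' : ℝ))
        ((q' : ℝ) ^ (-(1 + τ1))) ((q' : ℝ) ^ (-(1 + τ2)))).Nonempty) :
    (q : ℝ) ^ (-ρ1) ≤ r := by
  by_contra! hr
  obtain ⟨w, hwB, hw0, hw1⟩ := hmeet
  obtain ⟨w', hwB', hw0', hw1'⟩ := hmeet'
  have rpow_anti : ∀ {n : ℕ} {s t : ℝ}, 0 < n → s ≤ t → (n : ℝ) ^ (-t) ≤ (n : ℝ) ^ (-s) :=
    fun hn h => Real.rpow_le_rpow_of_exponent_le (by exact_mod_cast hn) (neg_le_neg h)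
  have dist_coord : ∀ i, |w' i - w i| ≤ 2 * r := fun i => by
    rw [← Real.dist_eq]
    calc dist (w' i) (w i) ≤ dist w' w := dist_le_pi_dist w' w i
      _ ≤ dist w' x + dist w x := dist_triangle_right _ _ _
      _ ≤ 2 * r := by linarith [Metric.mem_closedBall.1 hwB, Metric.mem_closedBall.1 hwB']
  have h0 := dist_coord 0
  have h1 := dist_coord 1
  have ha := rpow_anti hq hb1
  have hb := rpow_anti hq hb2
  have hab := rpow_anti hq hρ
  have ha' := rpow_anti hq' hb1
  have hb' := rpow_anti hq' hb2
  have ha0' : 0 ≤ (q' : ℝ) ^ (-ρ1) := by positivity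
  have hb0' : 0 ≤ (q' : ℝ) ^ (-ρ2) := by positivity
  refine hdisj.notMem_of_mem_left (a := w') ⟨?_, ?_⟩ ⟨by linarith, by linarith⟩
  · linarith [abs_sub_le (w' 0) (w 0) ((p 0 : ℝ) / q)]
  · linarith [abs_sub_le (w' 1) (w 1) ((p 1 : ℝ) / q)]
end
end

section
/- Let a > 0, b ∈ ℝ, d ≥ 0, and let K = [z1 − e1, z1 + e1] × [z2 − e2, z2 + e2] ⊆ ℝ² be a rectangle with e1, e2 > 0. Then the two-dimensional Lebesgue measure of {(x1, x2) ∈ K : |a·x1 − x2 + b| ≤ d} is at most 4·min{e1·d, e2·d/a}. -/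
open MeasureTheory Set

/-- If the vertical sections of a measurable set `s` have measure at most `c` and are empty
outside `A`, then `s` has product measure at most `c * μ A`. -/
theorem prod_measure_le_mul_of_sections {α β : Type*} [MeasurableSpace α] [MeasurableSpace β]
    (μ : Measure α) (ν : Measure β) [SFinite ν] {s : Set (α × β)} (hs : MeasurableSet s)
    {A : Set α} (hA : MeasurableSet A) (c : ENNReal) (hsub : ∀ p ∈ s, p.1 ∈ A)
    (hc : ∀ x ∈ A, ν (Prod.mk x ⁻¹' s) ≤ c) :
    μ.prod ν s ≤ c * μ A := by
  rw [Measure.prod_apply hs, ← lintegral_indicator_const hA]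
  refine lintegral_mono fun x => ?_
  by_cases hx : x ∈ A
  · simpa [hx] using hc x hx
  · have h : Prod.mk x ⁻¹' s = ∅ := eq_empty_of_forall_notMem fun y hy => hx (hsub _ hy)
    simp [h]

/-- for `a > 0`, `b ∈ ℝ`, `d ≥ 0` and a rectangle
`K = [z1-e1, z1+e1] × [z2-e2, z2+e2]` with `e1, e2 > 0`, the planar Lebesgue measure of
`{(x1,x2) ∈ K : |a x1 - x2 + b| ≤ d}` is at most `4 min{e1 d, e2 d / a}`. -/
theorem stmt12 (a b d z1 z2 e1 e2 : ℝ) (ha : 0 < a) (hd : 0 ≤ d)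
    (he1 : 0 < e1) (he2 : 0 < e2) :
    volume {x : ℝ × ℝ |
        (x.1 ∈ Set.Icc (z1 - e1) (z1 + e1) ∧ x.2 ∈ Set.Icc (z2 - e2) (z2 + e2)) ∧
        |a * x.1 - x.2 + b| ≤ d} ≤
      ENNReal.ofReal (4 * min (e1 * d) (e2 * d / a)) := by
  have hs : MeasurableSet {x : ℝ × ℝ |
      (x.1 ∈ Set.Icc (z1 - e1) (z1 + e1) ∧ x.2 ∈ Set.Icc (z2 - e2) (z2 + e2)) ∧
      |a * x.1 - x.2 + b| ≤ d} := by
    refine IsClosed.measurableSet ?_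
    refine ((isClosed_Icc.preimage continuous_fst).inter
      (isClosed_Icc.preimage continuous_snd)).inter ?_
    exact isClosed_le (f := fun x : ℝ × ℝ => |a * x.1 - x.2 + b|) (by fun_prop) continuous_const
  rw [mul_min_of_nonneg _ _ (by norm_num), ENNReal.ofReal_min]
  refine le_min ?_ ?_
  · rw [Measure.volume_eq_prod]
    refine (prod_measure_le_mul_of_sections volume volume hs
      (measurableSet_Icc (a := z1 - e1) (b := z1 + e1)) (ENNReal.ofReal (2 * d))
      (fun p hp => hp.1.1) fun x _ => ?_).trans (le_of_eq ?_)
    · refine (measure_mono (t := Icc (a * x + b - d) (a * x + b + d)) fun y hy => ?_).trans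
        (le_of_eq ?_)
      · have h := abs_le.1 hy.2
        dsimp only at h
        constructor <;> linarith
      · rw [Real.volume_Icc]
        ring_nf
    · rw [Real.volume_Icc, ← ENNReal.ofReal_mul (by positivity)]
      ring_nf
  · rw [Measure.volume_eq_prod, ← Measure.prod_swap, Measure.map_apply measurable_swap hs]
    refine (prod_measure_le_mul_of_sections volume volume (measurable_swap hs)
      (measurableSet_Icc (a := z2 - e2) (b := z2 + e2)) (ENNReal.ofReal (2 * d / a))
      (fun p hp => hp.1.2) fun y _ => ?_).trans (le_of_eq ?_)
    · refine (measure_mono (t := Icc ((y - b - d) / a) ((y - b + d) / a)) fun x hx => ?_).trans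
        (le_of_eq ?_)
      · have h : -d ≤ a * x - y + b ∧ a * x - y + b ≤ d := abs_le.1 hx.2
        rw [mem_Icc, div_le_iff₀ ha, le_div_iff₀ ha]
        constructor <;> linarith
      · rw [Real.volume_Icc]
        ring_nf
    · rw [Real.volume_Icc, ← ENNReal.ofReal_mul (by positivity)]
      ring_nf
end
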